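/- Let σ, b, r be positive reals with r − 1 > 0, r − 1 ≥ (b(b+σ−1)² − 4σ(b+σb−b²))/(3σ²), and suppose either (a) σ²(r−1)(b−4) ≤ 4σ(σb+b−b²) − b(b+σ−1)², or (b) P := b(b+σ−1)² − 4σ(σb+b−b²) + σ²(r−1)(b−4) > 0 and the quadratic equation (2σ−b+γ)²·P + 4bγ(σ+1)·Q = 0 in γ, where Q := b(b+σ−1)² − 4σ(σb+b−b²) − 3σ²(r−1), has two distinct real roots whose larger root is positive. If in addition (b−σ)(b−1) < σr < (b+1)(b+σ), then every solution u : [0,∞) → ℝ³ of the Lorenz system (i.e. u is differentiable with u′(t) = f(u(t)) for all t ≥ 0) that is bounded on [0,∞) converges as t → +∞ to some equilibrium point p ∈ ℝ³ (a point with f(p) = 0). -/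

import Mathlib

/-- The Lorenz vector field with parameters σ, b, r, on ℝ × ℝ × ℝ. -/
def lorenzField (σ b r : ℝ) (p : ℝ × ℝ × ℝ) : ℝ × ℝ × ℝ :=
  (σ * (p.2.1 - p.1), r * p.1 - p.2.1 - p.1 * p.2.2, -b * p.2.2 + p.1 * p.2.1)

/-- The derivative at `p` of the Lorenz vector field, applied to `a`. -/
def lorenzDeriv (σ b r : ℝ) (p a : ℝ × ℝ × ℝ) : ℝ × ℝ × ℝ :=
  (σ * (a.2.1 - a.1), (r - p.2.2) * a.1 - a.2.1 - p.1 * a.2.2,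
    p.2.1 * a.1 + p.1 * a.2.1 - b * a.2.2)

theorem exists_potential_coeffs {σ b r : ℝ} (hσ : 0 < σ) (hb : 0 < b) (h1 : 0 < r - 1)
    (hD : 0 < σ * r - (b - σ) * (b - 1))
    (hQ : b * (b + σ - 1)^2 - 4 * σ * (σ * b + b - b^2) - 3 * σ^2 * (r - 1) ≤ 0)
    (hab :
      (b * (b + σ - 1)^2 - 4 * σ * (σ * b + b - b^2) + σ^2 * (r - 1) * (b - 4) ≤ 0) ∨
      (0 < b * (b + σ - 1)^2 - 4 * σ * (σ * b + b - b^2) + σ^2 * (r - 1) * (b - 4) ∧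
        ∃ γ : ℝ, 0 < γ ∧
          (2 * σ - b + γ)^2 *
              (b * (b + σ - 1)^2 - 4 * σ * (σ * b + b - b^2) + σ^2 * (r - 1) * (b - 4)) +
            4 * b * γ * (σ + 1) *
              (b * (b + σ - 1)^2 - 4 * σ * (σ * b + b - b^2) - 3 * σ^2 * (r - 1)) = 0)) :
    ∃ k e d : ℝ, 0 ≤ k ∧ 
      σ^2 / (σ * r - (b - σ) * (b - 1)) - σ * e ≤ d ∧
      (r - 1) * (d - e) ≤ 
        4 * σ / b - (b + σ - 1)^2 / (σ * r - (b - σ) * (b - 1)) ∧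
      σ^2 / (σ * r - (b - σ) * (b - 1)) ≤ b * d + 2 * b * σ * k ∧
      (k * (2 * σ + b) + e) ^ 2 ≤
        4 * k * (b * d + 2 * b * σ * k - σ^2 / (σ * r - (b - σ) * (b - 1))) := by
  set D := σ * r - (b - σ) * (b - 1) with hDdef
  set P := b * (b + σ - 1)^2 - 4 * σ * (σ * b + b - b^2) + σ^2 * (r - 1) * (b - 4) with hP
  set Q := b * (b + σ - 1)^2 - 4 * σ * (σ * b + b - b^2) - 3 * σ^2 * (r - 1) with hQdef
  have hm1 : 4 * σ / b - (b + σ - 1)^2 / D = (r - 1) * (σ ^ 2 / D) - P / (b * D) := by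
    field_simp
    rw [hP, hDdef]; ring
  have hm2 : 4 * σ / b - (b + σ - 1)^2 / D = (r - 1) * (σ ^ 2 / D / b) - Q / (b * D) := by
    field_simp
    rw [hQdef, hDdef]; ring
  have hα : 0 < σ ^ 2 / D := by positivity
  rcases hab with ha | ⟨hPpos, γ, hγ, hroot⟩
  · rcases le_total 1 b with hb1 | hb1
    · refine ⟨0, 0, σ ^ 2 / D, le_rfl, by simp, ?_, ?_, by simp⟩
      · rw [hm1, sub_zero]
        have : P / (b * D) ≤ 0 := div_nonpos_of_nonpos_of_nonneg ha (by positivity)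
        linarith
      · nlinarith
    · refine ⟨0, 0, σ ^ 2 / D / b, le_rfl, ?_, ?_, ?_, by simp⟩
      · rw [mul_zero, sub_zero, le_div_iff₀ hb]; nlinarith
      · rw [hm2, sub_zero]
        have : Q / (b * D) ≤ 0 := div_nonpos_of_nonpos_of_nonneg hQ (by positivity)
        linarith
      · rw [mul_div_cancel₀ _ hb.ne']; linarith
  · set e := P / (b * D * (r - 1) * (σ + 1)) with he
    have he0 : 0 < e := by positivity
    have heP : P / (b * D) = e * (r - 1) * (σ + 1) := by rw [he]; field_simp
    have hd : (r - 1) * (σ ^ 2 / D - σ * e - e) = (r - 1) * (σ ^ 2 / D) - P / (b * D) := by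
      rw [heP]; ring
    have hkey : e * (2 * σ - b + γ) ^ 2 = 4 * γ * (b * (σ ^ 2 / D - σ * e - e) - σ ^ 2 / D) := by
      have h3 : (r - 1) * (b * (σ ^ 2 / D - σ * e - e) - σ ^ 2 / D) = - Q / D := by
        have : (r - 1) * (σ ^ 2 / D - σ * e - e) = (r - 1) * (σ ^ 2 / D / b) - Q / (b * D) := by
          rw [hd, ← hm1, hm2]
        calc _ = b * ((r - 1) * (σ ^ 2 / D - σ * e - e)) - (r - 1) * (σ ^ 2 / D) := by ring
          _ = _ := by rw [this]; field_simp; ring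
      have h4 : (r - 1) * (e * (2 * σ - b + γ) ^ 2) = 
          (r - 1) * (4 * γ * (b * (σ ^ 2 / D - σ * e - e) - σ ^ 2 / D)) := by
        calc (r - 1) * (e * (2 * σ - b + γ) ^ 2) 
              = (2 * σ - b + γ) ^ 2 * P / (b * D * (σ + 1)) := by rw [he]; field_simp
          _ = - (4 * b * γ * (σ + 1) * Q) / (b * D * (σ + 1)) := by
              rw [eq_neg_of_add_eq_zero_left hroot]
          _ = 4 * γ * (- Q / D) := by field_simp
          _ = _ := by rw [← h3]; ring
      exact mul_left_cancel₀ h1.ne' h4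
    have hk : (e / γ * (2 * σ + b) + e) ^ 2 =
        4 * (e / γ) * (b * (σ ^ 2 / D - σ * e) + 2 * b * σ * (e / γ) - σ ^ 2 / D) := by
      have : e * (2 * σ + b + γ) ^ 2 =
          4 * (γ * (b * (σ ^ 2 / D - σ * e) - σ ^ 2 / D) + 2 * b * σ * e) := by
        linear_combination hkey
      field_simp at this ⊢
      linear_combination this
    have hkpos : 0 < e / γ := by positivity
    refine ⟨e / γ, e, σ ^ 2 / D - σ * e, hkpos.le, le_rfl, ?_, ?_, hk.le⟩
    · rw [hm1, ← hd]
    · have h5 : 0 ≤ 4 * (e / γ) * 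
          (b * (σ ^ 2 / D - σ * e) + 2 * b * σ * (e / γ) - σ ^ 2 / D) := by
        rw [← hk]; positivity
      have := nonneg_of_mul_nonneg_right h5 (by positivity)
      linarith

/-- A polynomial potential whose derivative along the Lorenz flow compensates the deviation of the
area growth rate from its value at the origin, together with its first-order Taylor expansion. -/
theorem exists_potential {σ b r : ℝ} (hb : 0 < b) {k e d α : ℝ} (hσ : 0 < σ)
    (hk : 0 ≤ k) (hd : α - σ * e ≤ d)
    (hS : (r - 1) * (d - e) ≤ 4 * σ / b - α * (b + σ - 1)^2 / σ ^ 2)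
    (hz : α ≤ b * d + 2 * b * σ * k)
    (hdisc : (k * (2 * σ + b) + e) ^ 2 ≤ 4 * k * (b * d + 2 * b * σ * k - α)) :
    ∃ (v : ℝ × ℝ × ℝ → ℝ) (dv : ℝ × ℝ × ℝ → ℝ × ℝ × ℝ → ℝ)
      (rem : ℝ → ℝ × ℝ × ℝ → ℝ × ℝ × ℝ → ℝ),
      Continuous v ∧ Continuous (fun q : ℝ × (ℝ × ℝ × ℝ) × (ℝ × ℝ × ℝ) => rem q.1 q.2.1 q.2.2) ∧
      (∀ h p a, v (p + h • a) = v p + h * dv p a + h ^ 2 * rem h p a) ∧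
      ∀ p, dv p (lorenzField σ b r p) + 
        (α * p.2.2 ^ 2 - 4 * σ * p.2.2 + α * (p.2.1 + (b - 1) / σ * p.1) ^ 2) ≤ 0 := by
  set A := k / (4 * σ) with hA
  set B := -k with hB
  set C := d / 2 + σ * k with hC
  set G := - 4 * σ / b with hG
  set p22 := α - d - σ * e with hp22
  set F := (-2 * p22 - (2 * α * ((b - 1) / σ) + r * d + (σ + 1) * e + G)) / (2 * σ) with hF
  refine ⟨fun p => A * p.1 ^ 4 + B * p.1 ^ 2 * p.2.2 + C * p.2.2 ^ 2 + d / 2 * p.2.1 ^ 2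
      - e * p.1 * p.2.1 + F * p.1 ^ 2 + G * p.2.2,
    fun p a => A * (4 * p.1 ^ 3 * a.1) + B * (2 * p.1 * a.1 * p.2.2 + p.1 ^ 2 * a.2.2)
      + C * (2 * p.2.2 * a.2.2) + d / 2 * (2 * p.2.1 * a.2.1)
      - e * (a.1 * p.2.1 + p.1 * a.2.1) + F * (2 * p.1 * a.1) + G * a.2.2,
    fun h p a => A * (6 * p.1 ^ 2 * a.1 ^ 2 + 4 * h * p.1 * a.1 ^ 3 + h ^ 2 * a.1 ^ 4)
      + B * (2 * p.1 * a.1 * a.2.2 + a.1 ^ 2 * p.2.2 + h * a.1 ^ 2 * a.2.2) + C * a.2.2 ^ 2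
      + d / 2 * a.2.1 ^ 2 - e * a.1 * a.2.1 + F * a.1 ^ 2,
    by fun_prop, by fun_prop, ?_, ?_⟩
  · rintro h ⟨x, y, z⟩ ⟨a₁, a₂, a₃⟩
    simp only [Prod.smul_mk, Prod.mk_add_mk, smul_eq_mul]
    ring
  · rintro ⟨x, y, z⟩
    have hxz : -k * (x ^ 2) ^ 2 + (k * (2 * σ + b) + e) * x ^ 2 * z 
        + (α - b * d - 2 * b * σ * k) * z ^ 2 ≤ 0 := by
      rcases hk.eq_or_lt with hk0 | hk0
      · have : e = 0 := by
          rw [← hk0] at hdisc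
          exact pow_eq_zero_iff two_ne_zero |>.1 (le_antisymm (by linarith) (sq_nonneg e))
        rw [← hk0, this]
        rw [← hk0] at hz
        nlinarith [sq_nonneg z]
      · have h4 : 0 ≤ (2 * k * x ^ 2 - (k * (2 * σ + b) + e) * z) ^ 2 := sq_nonneg _
        have h5 : 4 * k * (-k * (x ^ 2) ^ 2 + (k * (2 * σ + b) + e) * x ^ 2 * z 
            + (α - b * d - 2 * b * σ * k) * z ^ 2) ≤ 0 := by
          linarith [mul_le_mul_of_nonneg_right hdisc (sq_nonneg z)]
        by_contra! hcon
        linarith [mul_pos hk0 hcon]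
    have hS' : α * ((b + σ - 1) / σ) ^ 2 + (r - 1) * (d - e) - 4 * σ / b ≤ 0 := by
      have : α * ((b + σ - 1) / σ) ^ 2 = α * (b + σ - 1)^2 / σ ^ 2 := by
        rw [div_pow]; ring
      linarith
    have hxy : p22 * (y - x) ^ 2 + 
        (α * ((b + σ - 1) / σ) ^ 2 + (r - 1) * (d - e) - 4 * σ / b) * x ^ 2 ≤ 0 := by
      have : p22 ≤ 0 := by rw [hp22]; linarith
      linarith [mul_nonneg (neg_nonneg.2 this) (sq_nonneg (y - x)),
        mul_nonneg (neg_nonneg.2 hS') (sq_nonneg x)]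
    refine le_of_eq_of_le ?_ (add_nonpos hxz hxy)
    simp only [lorenzField, hA, hB, hC, hG, hF, hp22]
    field_simp
    ring

theorem exists_abs_le_mul_norm_sq {X E : Type*} [TopologicalSpace X] [NormedAddCommGroup E]
    [NormedSpace ℝ E] [ProperSpace E] {S : Set X} (hS : IsCompact S) {g : X → E → ℝ}
    (hg : Continuous (Function.uncurry g)) (hom : ∀ x (t : ℝ) c, g x (t • c) = t ^ 2 * g x c) :
    ∃ C, 0 ≤ C ∧ ∀ x ∈ S, ∀ c, |g x c| ≤ C * ‖c‖ ^ 2 := by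
  obtain ⟨C, hC⟩ := (hS.prod (isCompact_sphere (0 : E) 1)).exists_bound_of_continuousOn
    hg.continuousOn
  refine ⟨max C 0, le_max_right _ _, fun x hx c => ?_⟩
  rcases eq_or_ne c 0 with rfl | hc
  · have := hom x 0 0
    simp at this
    simp [this]
  · have hc' : ‖c‖ ≠ 0 := norm_ne_zero_iff.2 hc
    have h1 := hC (x, ‖c‖⁻¹ • c) ⟨hx, by simp [norm_smul, hc']⟩
    have h2 : g x c = ‖c‖ ^ 2 * g x (‖c‖⁻¹ • c) := by
      rw [← hom, smul_smul, mul_inv_cancel₀ hc', one_smul]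
    rw [h2, abs_mul, abs_of_nonneg (sq_nonneg _), mul_comm]
    exact mul_le_mul_of_nonneg_right (h1.trans (le_max_left _ _)) (sq_nonneg _)

theorem exists_mul_norm_sq_le {X E : Type*} [TopologicalSpace X] [NormedAddCommGroup E]
    [NormedSpace ℝ E] [ProperSpace E] {S : Set X} (hS : IsCompact S) {g : X → E → ℝ}
    (hg : Continuous (Function.uncurry g)) (hom : ∀ x (t : ℝ) c, g x (t • c) = t ^ 2 * g x c)
    (hpos : ∀ x c, c ≠ 0 → 0 < g x c) :
    ∃ m, 0 < m ∧ ∀ x ∈ S, ∀ c, m * ‖c‖ ^ 2 ≤ g x c := by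
  rcases (S ×ˢ Metric.sphere (0 : E) 1).eq_empty_or_nonempty with hempty | hne
  · refine ⟨1, one_pos, fun x hx c => ?_⟩
    rcases eq_or_ne c 0 with rfl | hc
    · have := hom x 0 0
      simp at this
      simp [this]
    · have hc' : ‖c‖ ≠ 0 := norm_ne_zero_iff.2 hc
      have : (x, ‖c‖⁻¹ • c) ∈ S ×ˢ Metric.sphere (0 : E) 1 := ⟨hx, by simp [norm_smul, hc']⟩
      simp [hempty] at this
  · obtain ⟨⟨x₀, c₀⟩, h0, hmin⟩ := (hS.prod (isCompact_sphere (0 : E) 1)).exists_isMinOn hne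
      hg.continuousOn
    have hc₀ : c₀ ≠ 0 := by
      rintro rfl
      simpa using h0.2
    refine ⟨g x₀ c₀, hpos _ _ hc₀, fun x hx c => ?_⟩
    rcases eq_or_ne c 0 with rfl | hc
    · have := hom x 0 0
      simp at this
      simp [this]
    · have hc' : ‖c‖ ≠ 0 := norm_ne_zero_iff.2 hc
      have h1 := hmin (a := (x, ‖c‖⁻¹ • c)) ⟨hx, by simp [norm_smul, hc']⟩
      have h2 : g x c = ‖c‖ ^ 2 * g x (‖c‖⁻¹ • c) := by
        rw [← hom, smul_smul, mul_inv_cancel₀ hc', one_smul]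
      rw [h2, mul_comm]
      exact mul_le_mul_of_nonneg_left h1 (sq_nonneg _)

/-- The cross product on `ℝ × ℝ × ℝ`. -/
def tripleCross (a c : ℝ × ℝ × ℝ) : ℝ × ℝ × ℝ :=
  (a.2.1 * c.2.2 - a.2.2 * c.2.1, a.2.2 * c.1 - a.1 * c.2.2, a.1 * c.2.1 - a.2.1 * c.1)

/-- The infinitesimal action of the Lorenz linearization on cross products. -/
def lorenzArea (σ b r : ℝ) (p c : ℝ × ℝ × ℝ) : ℝ × ℝ × ℝ :=
  (-(1 + b) * c.1 + (p.2.2 - r) * c.2.1 - p.2.1 * c.2.2,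
    -σ * c.1 - (σ + b) * c.2.1 - p.1 * c.2.2, p.1 * c.2.1 - (σ + 1) * c.2.2)

/-- The cofactor matrix of the Lorenz linearization. -/
def lorenzCofactor (σ b r : ℝ) (p c : ℝ × ℝ × ℝ) : ℝ × ℝ × ℝ :=
  ((b + p.1 ^ 2) * c.1 + (b * (r - p.2.2) - p.1 * p.2.1) * c.2.1
      + ((r - p.2.2) * p.1 + p.2.1) * c.2.2,
    σ * b * c.1 + σ * b * c.2.1 + σ * (p.1 + p.2.1) * c.2.2,
    -σ * p.1 * c.1 - σ * p.1 * c.2.1 + σ * (1 - r + p.2.2) * c.2.2)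

theorem tripleCross_add_smul_lorenzDeriv (σ b r h : ℝ) (p a c : ℝ × ℝ × ℝ) :
    tripleCross (a + h • lorenzDeriv σ b r p a) (c + h • lorenzDeriv σ b r p c) =
      tripleCross a c + h • lorenzArea σ b r p (tripleCross a c)
        + h ^ 2 • lorenzCofactor σ b r p (tripleCross a c) := by
  obtain ⟨x, y, z⟩ := p
  obtain ⟨a₁, a₂, a₃⟩ := a
  obtain ⟨c₁, c₂, c₃⟩ := c
  simp only [tripleCross, lorenzDeriv, lorenzArea, lorenzCofactor, Prod.smul_mk, Prod.mk_add_mk,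
    smul_eq_mul, Prod.mk.injEq]
  refine ⟨?_, ?_, ?_⟩ <;> ring

/-- The symmetric bilinear form on cross products in which area contraction is measured. -/
def areaForm (α k : ℝ) (c e : ℝ × ℝ × ℝ) : ℝ :=
  α * ((c.1 - k * c.2.1) * (e.1 - k * e.2.1)) + c.2.1 * e.2.1 + c.2.2 * e.2.2

set_option maxHeartbeats 1000000 in
theorem areaForm_lorenzArea_le {σ b r D R : ℝ} (hσ : 0 < σ)
    (hD : D = σ * r - (b - σ) * (b - 1)) (hDpos : 0 < D)
    (hR : 0 < R) (hR2 : R ^ 2 = (σ - 1) ^ 2 + 4 * σ * r) (p c : ℝ × ℝ × ℝ) :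
    areaForm (σ ^ 2 / D) ((1 - b) / σ) c (lorenzArea σ b r p c) ≤
      (-(2 * b + σ + 1) / 2 + R / 2 + (σ ^ 2 / D * p.2.2 ^ 2 - 4 * σ * p.2.2
        + σ ^ 2 / D * (p.2.1 + (b - 1) / σ * p.1) ^ 2) / (4 * R)) *
        areaForm (σ ^ 2 / D) ((1 - b) / σ) c c := by
  obtain ⟨x, y, z⟩ := p
  obtain ⟨c₁, c₂, c₃⟩ := c
  set α := σ ^ 2 / D with hα
  have hαD : α * D = σ ^ 2 := by rw [hα]; field_simp
  have hαpos : 0 < α := by positivity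
  set w := α * z ^ 2 - 4 * σ * z + α * (y + (b - 1) / σ * x) ^ 2 with hw
  set m := R / 2 + w / (4 * R) with hm
  set g := (σ + 1 - 2 * b) / 2 with hg
  set ε := c₁ - (1 - b) / σ * c₂ with hε
  set p₁ := α * z - 2 * σ with hp₁
  set p₂ := - α * (y + (b - 1) / σ * x) with hp₂
  have hp : p₁ ^ 2 + p₂ ^ 2 = α * (w + 4 * D) := by
    rw [hp₁, hp₂, hw]; linear_combination (-4) * hαD
  have hw4 : 0 ≤ w + 4 * D := by
    refine nonneg_of_mul_nonneg_right (a := α) ?_ hαpos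
    rw [← hp]
    positivity
  have hRg : R ^ 2 = 4 * g ^ 2 + 4 * D := by rw [hR2, hg, hD]; ring
  have hm2 : 4 * (m ^ 2 - g ^ 2) = w + 4 * D + w ^ 2 / (4 * R ^ 2) := by
    have : 4 * m ^ 2 = R ^ 2 + w + w ^ 2 / (4 * R ^ 2) := by rw [hm]; field_simp; ring
    linarith
  have hmg : g ^ 2 < m ^ 2 := by
    have h0 : 0 ≤ w ^ 2 / (4 * R ^ 2) := by positivity
    rcases hw4.eq_or_lt with h | h
    · have : 0 < w ^ 2 / (4 * R ^ 2) := by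
        have : w ≠ 0 := by intro h'; linarith
        positivity
      linarith
    · linarith
  have hm0 : 0 < m := by
    have : m = (2 * R ^ 2 + w) / (4 * R) := by rw [hm]; field_simp; ring
    rw [this]
    apply div_pos _ (by positivity)
    linarith [sq_nonneg g, pow_pos hR 2]
  have hmg0 : 0 < m + g := by
    have := abs_lt_of_sq_lt_sq hmg hm0.le
    linarith [neg_abs_le g, (abs_lt.1 this).1]
  have hform : 0 ≤ (m - g) * α * ε ^ 2 + (m + g) * (c₂ ^ 2 + c₃ ^ 2) - ε * (p₁ * c₂ + p₂ * c₃) := by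
    have h0 : 0 ≤ w ^ 2 / (4 * R ^ 2) := by positivity
    have h1 : p₁ ^ 2 + p₂ ^ 2 ≤ 4 * α * (m ^ 2 - g ^ 2) := by
      calc p₁ ^ 2 + p₂ ^ 2 ≤ α * (w + 4 * D + w ^ 2 / (4 * R ^ 2)) := by
            rw [hp]; exact mul_le_mul_of_nonneg_left (by linarith) hαpos.le
        _ = 4 * α * (m ^ 2 - g ^ 2) := by rw [← hm2]; ring
    have h2 : 0 ≤ (m + g) * ((m - g) * α * ε ^ 2 + (m + g) * (c₂ ^ 2 + c₃ ^ 2)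
        - ε * (p₁ * c₂ + p₂ * c₃)) := by
      have h3 : (m + g) * ((m - g) * α * ε ^ 2 + (m + g) * (c₂ ^ 2 + c₃ ^ 2)
          - ε * (p₁ * c₂ + p₂ * c₃)) =
          (ε * p₁ / 2 - (m + g) * c₂) ^ 2 + (ε * p₂ / 2 - (m + g) * c₃) ^ 2
            + ε ^ 2 * (4 * α * (m ^ 2 - g ^ 2) - (p₁ ^ 2 + p₂ ^ 2)) / 4 := by ring
      rw [h3]
      have := sub_nonneg.2 h1
      positivity
    exact nonneg_of_mul_nonneg_right h2 hmg0
  have hμ : -(2 * b + σ + 1) / 2 + R / 2 + w / (4 * R) = m - b - (σ + 1) / 2 := by rw [hm]; ring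
  have hlhs : areaForm α ((1 - b) / σ) (c₁, c₂, c₃) (lorenzArea σ b r (x, y, z) (c₁, c₂, c₃)) =
      -2 * b * α * ε ^ 2 - (σ + 1) * (c₂ ^ 2 + c₃ ^ 2) + ε * (p₁ * c₂ + p₂ * c₃) := by
    have e1 : α * r = (σ + α * ((b - σ) * (b - 1)) / σ) := by
      field_simp
      rw [← hαD, hD]; ring
    simp only [areaForm, lorenzArea]
    rw [hp₁, hp₂, ← hε]
    have e2 : c₁ = ε + (1 - b) / σ * c₂ := by rw [hε]; ring
    rw [e2]
    field_simp at e1 ⊢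
    linear_combination (- c₂ * ε) * e1
  rw [hμ, hlhs]
  simp only [areaForm]
  rw [← hε]
  have : m - b - (σ + 1) / 2 = m - g - 2 * b := by rw [hg]; ring
  have h' : (m - b - (σ + 1) / 2) * (α * (ε * ε) + c₂ * c₂ + c₃ * c₃) =
      (m - g - 2 * b) * α * ε ^ 2 + (m + g - (σ + 1)) * (c₂ ^ 2 + c₃ ^ 2) := by
    rw [hg]; ring
  rw [h']
  linarith

set_option maxHeartbeats 1000000 in
/-- A Riemannian metric on cross products which decays exponentially along Euler steps. -/
theorem exists_area_metric {σ b r : ℝ} (hσ : 0 < σ) (hb : 0 < b) (hr : 0 < r)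
    (hD : 0 < σ * r - (b - σ) * (b - 1)) (h4 : σ * r < (b + 1) * (b + σ))
    {v : ℝ × ℝ × ℝ → ℝ} {dv : ℝ × ℝ × ℝ → ℝ × ℝ × ℝ → ℝ}
    {rem : ℝ → ℝ × ℝ × ℝ → ℝ × ℝ × ℝ → ℝ} (hv : Continuous v)
    (hrem : Continuous (fun q : ℝ × (ℝ × ℝ × ℝ) × (ℝ × ℝ × ℝ) => rem q.1 q.2.1 q.2.2))
    (htaylor : ∀ h p a, v (p + h • a) = v p + h * dv p a + h ^ 2 * rem h p a)
    (hdv : ∀ p, dv p (lorenzField σ b r p) +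
        (σ ^ 2 / (σ * r - (b - σ) * (b - 1)) * p.2.2 ^ 2 - 4 * σ * p.2.2 +
          σ ^ 2 / (σ * r - (b - σ) * (b - 1)) * (p.2.1 + (b - 1) / σ * p.1) ^ 2) ≤ 0)
    {K : Set (ℝ × ℝ × ℝ)} (hK : IsCompact K) :
    ∃ (G : ℝ × ℝ × ℝ → ℝ × ℝ × ℝ → ℝ) (m C κ h₀ : ℝ), 0 < m ∧ 0 ≤ C ∧ 0 < κ ∧ 0 < h₀ ∧
      (∀ q ∈ K, ∀ c, m * ‖c‖ ^ 2 ≤ G q c ∧ G q c ≤ C * ‖c‖ ^ 2) ∧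
      ∀ h, 0 < h → h ≤ h₀ → ∀ q ∈ K, ∀ c,
        G (q + h • lorenzField σ b r q)
          (c + h • lorenzArea σ b r q c + h ^ 2 • lorenzCofactor σ b r q c) ≤
            Real.exp (-κ * h) * G q c := by
  set D := σ * r - (b - σ) * (b - 1) with hDdef
  set α := σ ^ 2 / D with hα
  have hαpos : 0 < α := by positivity
  set N := areaForm α ((1 - b) / σ) with hN
  set R := Real.sqrt ((σ - 1) ^ 2 + 4 * σ * r) with hRdef
  have hRpos : 0 < R := Real.sqrt_pos.2 (by positivity)
  have hR2 : R ^ 2 = (σ - 1) ^ 2 + 4 * σ * r := Real.sq_sqrt (by positivity)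
  have hRlt : R < 2 * b + σ + 1 := by
    apply lt_of_pow_lt_pow_left₀ 2 (by positivity)
    have : (2 * b + σ + 1) ^ 2 = (σ - 1) ^ 2 + 4 * ((b + 1) * (b + σ)) := by ring
    rw [hR2, this]
    linarith
  set κ := (2 * b + σ + 1 - R) / 2 with hκ
  have hκpos : 0 < κ := by rw [hκ]; linarith
  have hNc : Continuous (fun q : (ℝ × ℝ × ℝ) × (ℝ × ℝ × ℝ) => N q.1 q.2) := by
    simp only [hN, areaForm]; fun_prop
  have hNhom : ∀ (t : ℝ) c, N (t • c) (t • c) = t ^ 2 * N c c := by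
    rintro t ⟨c₁, c₂, c₃⟩
    simp only [hN, areaForm, Prod.smul_mk, smul_eq_mul]; ring
  have hNpos : ∀ c, c ≠ 0 → 0 < N c c := by
    rintro ⟨c₁, c₂, c₃⟩ hc
    simp only [hN, areaForm]
    by_contra! hcon
    apply hc
    have e1 := mul_nonneg hαpos.le (mul_self_nonneg (c₁ - (1 - b) / σ * c₂))
    have e2 := mul_self_nonneg c₂
    have e3 := mul_self_nonneg c₃
    have hc2 : c₂ = 0 := mul_self_eq_zero.1 (by linarith)
    have hc3 : c₃ = 0 := mul_self_eq_zero.1 (by linarith)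
    have : α * (c₁ * c₁) ≤ 0 := by simpa [hc2, hc3] using hcon
    have hc1 : c₁ = 0 := by
      by_contra h
      have : 0 < α * (c₁ * c₁) := mul_pos hαpos (mul_self_pos.2 h)
      linarith
    simp [hc1, hc2, hc3]
  set S := Set.Icc (0 : ℝ) 1 ×ˢ K
  have hS : IsCompact S := isCompact_Icc.prod hK
  obtain ⟨C₁, hC₁⟩ := hS.exists_bound_of_continuousOn
    (f := fun q => rem q.1 q.2 (lorenzField σ b r q.2)) (by
      apply Continuous.continuousOn
      refine hrem.comp (f := fun q : ℝ × (ℝ × ℝ × ℝ) => (q.1, q.2, lorenzField σ b r q.2)) ?_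
      unfold lorenzField
      fun_prop)
  set R₂ : ℝ × (ℝ × ℝ × ℝ) → ℝ × ℝ × ℝ → ℝ := fun q c =>
    N (lorenzArea σ b r q.2 c + q.1 • lorenzCofactor σ b r q.2 c)
      (lorenzArea σ b r q.2 c + q.1 • lorenzCofactor σ b r q.2 c)
      + 2 * N c (lorenzCofactor σ b r q.2 c) with hR₂
  obtain ⟨C₂, hC₂0, hC₂⟩ := exists_abs_le_mul_norm_sq hS (g := R₂) (by
      simp only [hR₂, hN, areaForm, lorenzArea, lorenzCofactor, Function.uncurry_def]
      fun_prop) (by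
      rintro ⟨h, x, y, z⟩ t ⟨c₁, c₂, c₃⟩
      simp only [hR₂, hN, areaForm, lorenzArea, lorenzCofactor, Prod.smul_mk, Prod.mk_add_mk,
        smul_eq_mul]
      ring)
  obtain ⟨m₀, hm₀, hNm⟩ := exists_mul_norm_sq_le (isCompact_singleton (x := ()))
    (g := fun _ c => N c c) (by
      simp only [hN, areaForm, Function.uncurry_def]; fun_prop) (fun _ => hNhom) (fun _ => hNpos)
  replace hNm : ∀ c, m₀ * ‖c‖ ^ 2 ≤ N c c := fun c => hNm () rfl c
  set G : ℝ × ℝ × ℝ → ℝ × ℝ × ℝ → ℝ := fun q c => Real.exp (v q / (2 * R)) * N c c with hG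
  have hGc : Continuous (Function.uncurry G) := by
    simp only [hG, hN, areaForm, Function.uncurry_def]; fun_prop
  have hGhom : ∀ x (t : ℝ) c, G x (t • c) = t ^ 2 * G x c := by
    intro x t c
    simp only [hG, hNhom]; ring
  obtain ⟨m, hm, hGm⟩ := exists_mul_norm_sq_le hK hGc hGhom
    (fun x c hc => mul_pos (Real.exp_pos _) (hNpos c hc))
  obtain ⟨C, hC, hGC⟩ := exists_abs_le_mul_norm_sq hK hGc hGhom
  set C₃ := |C₁| / (2 * R) + C₂ / m₀ with hC₃
  have hC₃0 : 0 ≤ C₃ := by positivity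
  refine ⟨G, m, C, κ, min 1 (κ / (C₃ + 1)), hm, hC, hκpos, by positivity,
    fun q hq c => ⟨hGm q hq c, (le_abs_self _).trans (hGC q hq c)⟩, ?_⟩
  intro h hh hh' q hq c
  have hh1 : h ≤ 1 := hh'.trans (min_le_left _ _)
  have hhκ : C₃ * h ≤ κ := by
    have := hh'.trans (min_le_right _ _)
    rw [le_div_iff₀ (by positivity)] at this
    linarith
  set w := α * q.2.2 ^ 2 - 4 * σ * q.2.2 + α * (q.2.1 + (b - 1) / σ * q.1) ^ 2 with hw
  set μ := -(2 * b + σ + 1) / 2 + R / 2 + w / (4 * R) with hμ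
  have hqS : (h, q) ∈ S := ⟨⟨hh.le, hh1⟩, hq⟩
  have hNle : N c (lorenzArea σ b r q c) ≤ μ * N c c :=
    areaForm_lorenzArea_le hσ hDdef hD hRpos hR2 q c
  have hN0 : 0 ≤ N c c := le_trans (by positivity) (hNm c)
  have hR₂le : R₂ (h, q) c ≤ C₂ / m₀ * N c c := by
    refine (le_abs_self _).trans ((hC₂ _ hqS c).trans ?_)
    rw [div_mul_eq_mul_div, le_div_iff₀ hm₀]
    linarith [mul_le_mul_of_nonneg_left (hNm c) hC₂0]
  have hNexp : N (c + h • lorenzArea σ b r q c + h ^ 2 • lorenzCofactor σ b r q c)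
      (c + h • lorenzArea σ b r q c + h ^ 2 • lorenzCofactor σ b r q c) =
      N c c + 2 * h * N c (lorenzArea σ b r q c) + h ^ 2 * R₂ (h, q) c := by
    simp only [hR₂]
    generalize lorenzArea σ b r q c = A
    generalize lorenzCofactor σ b r q c = B
    simp only [hN, areaForm, Prod.fst_add, Prod.snd_add, Prod.smul_fst, Prod.smul_snd, smul_eq_mul]
    ring
  have hNstep : N (c + h • lorenzArea σ b r q c + h ^ 2 • lorenzCofactor σ b r q c)
      (c + h • lorenzArea σ b r q c + h ^ 2 • lorenzCofactor σ b r q c) ≤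
      Real.exp (2 * h * μ + h ^ 2 * (C₂ / m₀)) * N c c := by
    rw [hNexp]
    calc _ ≤ (1 + (2 * h * μ + h ^ 2 * (C₂ / m₀))) * N c c := by
          linarith [mul_le_mul_of_nonneg_left hNle (by positivity : 0 ≤ 2 * h),
            mul_le_mul_of_nonneg_left hR₂le (by positivity : 0 ≤ h ^ 2)]
      _ ≤ _ := by
          apply mul_le_mul_of_nonneg_right _ hN0
          linarith [Real.add_one_le_exp (2 * h * μ + h ^ 2 * (C₂ / m₀))]
  have hvstep : v (q + h • lorenzField σ b r q) ≤ v q - h * w + h ^ 2 * |C₁| := by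
    rw [htaylor]
    have e1 := hdv q
    have e2 : rem h q (lorenzField σ b r q) ≤ |C₁| :=
      (le_abs_self _).trans ((hC₁ _ hqS).trans (le_abs_self _))
    linarith [mul_le_mul_of_nonneg_left e2 (by positivity : 0 ≤ h ^ 2),
      mul_le_mul_of_nonneg_left e1 hh.le]
  simp only [hG]
  calc _ ≤ Real.exp ((v q - h * w + h ^ 2 * |C₁|) / (2 * R)) *
        (Real.exp (2 * h * μ + h ^ 2 * (C₂ / m₀)) * N c c) := by
        apply mul_le_mul _ hNstep _ (Real.exp_pos _).le
        · gcongr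
        · exact le_trans (by positivity) (hNm _)
    _ = Real.exp (v q / (2 * R) + (-2 * κ * h + C₃ * h ^ 2)) * N c c := by
        rw [← mul_assoc, ← Real.exp_add]
        congr 2
        rw [hμ, hκ, hC₃]
        field_simp
        ring
    _ ≤ Real.exp (v q / (2 * R) + (-κ * h)) * N c c := by
        apply mul_le_mul_of_nonneg_right _ hN0
        gcongr
        linarith [mul_le_mul_of_nonneg_right hhκ hh.le]
    _ = _ := by rw [add_comm, Real.exp_add]; ring

/-- The dot product on `ℝ × ℝ × ℝ`. -/
def tripleDot (a c : ℝ × ℝ × ℝ) : ℝ :=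
  a.1 * c.1 + a.2.1 * c.2.1 + a.2.2 * c.2.2

/-- The (constant) second derivative of the Lorenz vector field. -/
def lorenzHess (a c : ℝ × ℝ × ℝ) : ℝ × ℝ × ℝ :=
  (0, -(a.1 * c.2.2 + a.2.2 * c.1), a.1 * c.2.1 + a.2.1 * c.1)

theorem continuous_lorenzField (σ b r : ℝ) : Continuous (lorenzField σ b r) := by
  unfold lorenzField; fun_prop

/-- The three coordinates of a differentiable curve. -/
theorem HasDerivAt.triple_coords {P : ℝ → ℝ × ℝ × ℝ} {P' : ℝ × ℝ × ℝ} {t : ℝ}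
    (hP : HasDerivAt P P' t) :
    HasDerivAt (fun t => (P t).1) P'.1 t ∧ HasDerivAt (fun t => (P t).2.1) P'.2.1 t ∧
      HasDerivAt (fun t => (P t).2.2) P'.2.2 t := by
  refine ⟨?_, ?_, ?_⟩
  · exact (ContinuousLinearMap.fst ℝ ℝ (ℝ × ℝ)).hasFDerivAt.comp_hasDerivAt t hP
  · exact ((ContinuousLinearMap.fst ℝ ℝ ℝ).comp
      (ContinuousLinearMap.snd ℝ ℝ (ℝ × ℝ))).hasFDerivAt.comp_hasDerivAt t hP
  · exact ((ContinuousLinearMap.snd ℝ ℝ ℝ).comp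
      (ContinuousLinearMap.snd ℝ ℝ (ℝ × ℝ))).hasFDerivAt.comp_hasDerivAt t hP

theorem HasDerivAt.tripleDot {P Q : ℝ → ℝ × ℝ × ℝ} {P' Q' : ℝ × ℝ × ℝ} {t : ℝ}
    (hP : HasDerivAt P P' t) (hQ : HasDerivAt Q Q' t) :
    HasDerivAt (fun t => tripleDot (P t) (Q t)) (tripleDot P' (Q t) + tripleDot (P t) Q') t := by
  obtain ⟨p1, p2, p3⟩ := hP.triple_coords
  obtain ⟨q1, q2, q3⟩ := hQ.triple_coords
  have := ((p1.mul q1).add (p2.mul q2)).add (p3.mul q3)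
  convert! this using 1
  simp only [_root_.tripleDot]; ring

theorem HasDerivAt.lorenzField {σ b r : ℝ} {P : ℝ → ℝ × ℝ × ℝ} {P' : ℝ × ℝ × ℝ} {t : ℝ}
    (hP : HasDerivAt P P' t) :
    HasDerivAt (fun t => lorenzField σ b r (P t)) (lorenzDeriv σ b r (P t) P') t := by
  obtain ⟨p1, p2, p3⟩ := hP.triple_coords
  have h1 := (p2.sub p1).const_mul σ
  have h2 := ((p1.const_mul r).sub p2).sub (p1.mul p3)
  have h3 := (p3.const_mul (-b)).add (p1.mul p2)
  convert! h1.prodMk (h2.prodMk h3) using 1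
  simp only [lorenzDeriv, Prod.mk.injEq, true_and]
  constructor <;> ring

theorem HasDerivAt.lorenzDeriv {σ b r : ℝ} {P Q : ℝ → ℝ × ℝ × ℝ} {P' Q' : ℝ × ℝ × ℝ} {t : ℝ}
    (hP : HasDerivAt P P' t) (hQ : HasDerivAt Q Q' t) :
    HasDerivAt (fun t => lorenzDeriv σ b r (P t) (Q t))
      (lorenzDeriv σ b r (P t) Q' + lorenzHess P' (Q t)) t := by
  obtain ⟨p1, p2, p3⟩ := hP.triple_coords
  obtain ⟨q1, q2, q3⟩ := hQ.triple_coords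
  have h1 := (q2.sub q1).const_mul σ
  have h2 := (((p3.const_sub r).mul q1).sub q2).sub (p1.mul q3)
  have h3 := ((p2.mul q1).add (p1.mul q2)).sub (q3.const_mul b)
  convert! h1.prodMk (h2.prodMk h3) using 1
  simp only [_root_.lorenzDeriv, lorenzHess, Prod.mk_add_mk, Prod.mk.injEq, add_zero, true_and]
  constructor <;> ring

theorem lorenzHess_comm (a c : ℝ × ℝ × ℝ) : lorenzHess a c = lorenzHess c a := by
  simp only [lorenzHess, Prod.mk.injEq, true_and]
  constructor <;> ring

/-- One Euler step together with its tangent map. -/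
def eulerTangent (σ b r h : ℝ) (w : (ℝ × ℝ × ℝ) × (ℝ × ℝ × ℝ)) : (ℝ × ℝ × ℝ) × (ℝ × ℝ × ℝ) :=
  (w.1 + h • lorenzField σ b r w.1, w.2 + h • lorenzDeriv σ b r w.1 w.2)

/-- One Euler step acting on a point of a two-parameter family, its two first partial derivatives
and its mixed second partial derivative. -/
def eulerJet (σ b r h : ℝ) (w : (ℝ × ℝ × ℝ) × (ℝ × ℝ × ℝ) × (ℝ × ℝ × ℝ) × (ℝ × ℝ × ℝ)) :
    (ℝ × ℝ × ℝ) × (ℝ × ℝ × ℝ) × (ℝ × ℝ × ℝ) × (ℝ × ℝ × ℝ) :=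
  (w.1 + h • lorenzField σ b r w.1, w.2.1 + h • lorenzDeriv σ b r w.1 w.2.1,
    w.2.2.1 + h • lorenzDeriv σ b r w.1 w.2.2.1,
    w.2.2.2 + h • (lorenzDeriv σ b r w.1 w.2.2.2 + lorenzHess w.2.1 w.2.2.1))

theorem continuous_eulerTangent (σ b r h : ℝ) : Continuous (eulerTangent σ b r h) := by
  unfold eulerTangent lorenzField lorenzDeriv; fun_prop

theorem continuous_eulerJet (σ b r h : ℝ) : Continuous (eulerJet σ b r h) := by
  unfold eulerJet lorenzField lorenzDeriv lorenzHess; fun_prop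

theorem eulerTangent_iterate_smul (σ b r h t : ℝ) (n : ℕ) (p a : ℝ × ℝ × ℝ) :
    (eulerTangent σ b r h)^[n] (p, t • a) =
      (((eulerTangent σ b r h)^[n] (p, a)).1, t • ((eulerTangent σ b r h)^[n] (p, a)).2) := by
  have hsmul : ∀ p a, lorenzDeriv σ b r p (t • a) = t • lorenzDeriv σ b r p a := by
    intro p a
    simp only [lorenzDeriv, Prod.smul_fst, Prod.smul_snd, Prod.smul_mk, smul_eq_mul, Prod.mk.injEq]
    refine ⟨?_, ?_, ?_⟩ <;> ring
  induction n with
  | zero => rfl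
  | succ n ih =>
    rw [Function.iterate_succ_apply', ih, Function.iterate_succ_apply']
    simp only [eulerTangent, hsmul, smul_add, smul_comm t h]

theorem eulerJet_iterate_tangent (σ b r h : ℝ) (n : ℕ)
    (w : (ℝ × ℝ × ℝ) × (ℝ × ℝ × ℝ) × (ℝ × ℝ × ℝ) × (ℝ × ℝ × ℝ)) :
    (((eulerJet σ b r h)^[n] w).1, ((eulerJet σ b r h)^[n] w).2.2.1) =
      (eulerTangent σ b r h)^[n] (w.1, w.2.2.1) := by
  induction n with
  | zero => rfl
  | succ n ih =>
    rw [Function.iterate_succ_apply', Function.iterate_succ_apply', ← ih]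
    rfl

theorem hasDerivAt_eulerJet_iterate_left {σ b r h : ℝ} {t : ℝ}
    {w : ℝ → (ℝ × ℝ × ℝ) × (ℝ × ℝ × ℝ) × (ℝ × ℝ × ℝ) × (ℝ × ℝ × ℝ)}
    (h1 : HasDerivAt (fun s => (w s).1) (w t).2.1 t)
    (h2 : HasDerivAt (fun s => (w s).2.2.1) (w t).2.2.2 t) (n : ℕ) :
    HasDerivAt (fun s => ((eulerJet σ b r h)^[n] (w s)).1) ((eulerJet σ b r h)^[n] (w t)).2.1 t ∧
    HasDerivAt (fun s => ((eulerJet σ b r h)^[n] (w s)).2.2.1)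
      ((eulerJet σ b r h)^[n] (w t)).2.2.2 t := by
  induction n with
  | zero => exact ⟨h1, h2⟩
  | succ n ih =>
    simp only [Function.iterate_succ_apply']
    exact ⟨ih.1.add (ih.1.lorenzField.const_smul h),
      ih.2.add ((ih.1.lorenzDeriv ih.2).const_smul h)⟩

theorem hasDerivAt_eulerJet_iterate_right {σ b r h : ℝ} {t : ℝ}
    {w : ℝ → (ℝ × ℝ × ℝ) × (ℝ × ℝ × ℝ) × (ℝ × ℝ × ℝ) × (ℝ × ℝ × ℝ)}
    (h1 : HasDerivAt (fun s => (w s).1) (w t).2.2.1 t)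
    (h2 : HasDerivAt (fun s => (w s).2.1) (w t).2.2.2 t) (n : ℕ) :
    HasDerivAt (fun s => ((eulerJet σ b r h)^[n] (w s)).1)
      ((eulerJet σ b r h)^[n] (w t)).2.2.1 t ∧
    HasDerivAt (fun s => ((eulerJet σ b r h)^[n] (w s)).2.1)
      ((eulerJet σ b r h)^[n] (w t)).2.2.2 t := by
  induction n with
  | zero => exact ⟨h1, h2⟩
  | succ n ih =>
    simp only [Function.iterate_succ_apply']
    refine ⟨ih.1.add (ih.1.lorenzField.const_smul h), ?_⟩
    simp only [eulerJet, lorenzHess_comm (((eulerJet σ b r h)^[n] (w t)).2.1)]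
    exact ih.2.add ((ih.1.lorenzDeriv ih.2).const_smul h)

/-- The parabola through the equilibria, with its velocity scaled by `c`. -/
noncomputable def parabolaTangent (b c x : ℝ) : (ℝ × ℝ × ℝ) × (ℝ × ℝ × ℝ) :=
  ((x, x, x ^ 2 / b), c • (1, 1, 2 * x / b))

/-- The segment joining `p` to its projection on the parabola through the equilibria, moved
along the Lorenz field, with its partial derivatives. -/
noncomputable def segmentJet (σ b r s : ℝ) (p : ℝ × ℝ × ℝ) :
    (ℝ × ℝ × ℝ) × (ℝ × ℝ × ℝ) × (ℝ × ℝ × ℝ) × (ℝ × ℝ × ℝ) :=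
  ((parabolaTangent b (σ * (p.2.1 - p.1)) p.1).1
      + s • (p - (parabolaTangent b (σ * (p.2.1 - p.1)) p.1).1),
    p - (parabolaTangent b (σ * (p.2.1 - p.1)) p.1).1,
    (parabolaTangent b (σ * (p.2.1 - p.1)) p.1).2
      + s • (lorenzField σ b r p - (parabolaTangent b (σ * (p.2.1 - p.1)) p.1).2),
    lorenzField σ b r p - (parabolaTangent b (σ * (p.2.1 - p.1)) p.1).2)

theorem continuous_segmentJet (σ b r : ℝ) :
    Continuous (fun q : ℝ × (ℝ × ℝ × ℝ) => segmentJet σ b r q.1 q.2) := by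
  unfold segmentJet parabolaTangent lorenzField
  simp only [div_eq_mul_inv]
  fun_prop

theorem hasDerivAt_segmentJet_left (σ b r s : ℝ) (p : ℝ × ℝ × ℝ) :
    HasDerivAt (fun s => (segmentJet σ b r s p).1) (segmentJet σ b r s p).2.1 s ∧
    HasDerivAt (fun s => (segmentJet σ b r s p).2.2.1) (segmentJet σ b r s p).2.2.2 s := by
  have key : ∀ a c : ℝ × ℝ × ℝ, HasDerivAt (fun s : ℝ => a + s • c) c s := by
    intro a c
    simpa using ((hasDerivAt_id s).smul_const c).const_add a
  exact ⟨key _ _, key _ _⟩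

theorem hasDerivAt_segmentJet_right {σ b r : ℝ} (s : ℝ) {u : ℝ → ℝ × ℝ × ℝ} {t : ℝ}
    (hu : HasDerivAt u (lorenzField σ b r (u t)) t) :
    HasDerivAt (fun t => (segmentJet σ b r s (u t)).1) (segmentJet σ b r s (u t)).2.2.1 t ∧
    HasDerivAt (fun t => (segmentJet σ b r s (u t)).2.1) (segmentJet σ b r s (u t)).2.2.2 t := by
  have hπ : HasDerivAt (fun t => (parabolaTangent b (σ * ((u t).2.1 - (u t).1)) (u t).1).1)
      (parabolaTangent b (σ * ((u t).2.1 - (u t).1)) (u t).1).2 t := by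
    have hu1 := hu.triple_coords.1
    have := hu1.prodMk (hu1.prodMk ((hu1.pow 2).div_const b))
    convert! this using 1
    simp only [parabolaTangent, lorenzField, Prod.smul_mk, smul_eq_mul, Prod.mk.injEq, mul_one,
      true_and, Nat.cast_ofNat]
    ring
  exact ⟨hπ.add ((hu.sub hπ).const_smul s), hu.sub hπ⟩

theorem continuous_tripleDot :
    Continuous (fun q : (ℝ × ℝ × ℝ) × (ℝ × ℝ × ℝ) => tripleDot q.1 q.2) := by
  unfold tripleDot; fun_prop

/-- The antisymmetric part of the Lorenz linearization. -/
def lorenzCurl (σ b r : ℝ) (p a c : ℝ × ℝ × ℝ) : ℝ :=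
  tripleDot (lorenzDeriv σ b r p c) a - tripleDot (lorenzDeriv σ b r p a) c

/-- The line integral of the pulled back Lorenz field, along the parabola through the
equilibria and then along a segment ending at `p`. -/
noncomputable def lineFunctional (σ b r h : ℝ) (n : ℕ) (p : ℝ × ℝ × ℝ) : ℝ :=
  (∫ x in (0 : ℝ)..p.1,
    tripleDot (lorenzField σ b r ((eulerTangent σ b r h)^[n] (parabolaTangent b 1 x)).1)
      ((eulerTangent σ b r h)^[n] (parabolaTangent b 1 x)).2) +
  ∫ s in (0 : ℝ)..1,
    tripleDot (lorenzField σ b r ((eulerJet σ b r h)^[n] (segmentJet σ b r s p)).1)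
      ((eulerJet σ b r h)^[n] (segmentJet σ b r s p)).2.1

theorem hasDerivAt_lineFunctional {σ b r : ℝ} {u : ℝ → ℝ × ℝ × ℝ} {K : Set (ℝ × ℝ × ℝ)}
    (hK : IsCompact K) (huK : ∀ t, 0 ≤ t → u t ∈ K)
    (hu : ∀ t : ℝ, 0 ≤ t → HasDerivAt u (lorenzField σ b r (u t)) t) (h : ℝ) (n : ℕ)
    {t : ℝ} (ht : 0 < t) :
    HasDerivAt (fun t => lineFunctional σ b r h n (u t))
      (tripleDot (lorenzField σ b r
          ((eulerTangent σ b r h)^[n] (u t, lorenzField σ b r (u t))).1)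
        ((eulerTangent σ b r h)^[n] (u t, lorenzField σ b r (u t))).2 +
      ∫ s in (0 : ℝ)..1, lorenzCurl σ b r ((eulerJet σ b r h)^[n] (segmentJet σ b r s (u t))).1
        ((eulerJet σ b r h)^[n] (segmentJet σ b r s (u t))).2.1
        ((eulerJet σ b r h)^[n] (segmentJet σ b r s (u t))).2.2.1) t := by
  set w : ℝ → ℝ × ℝ × ℝ → _ := fun s p => (eulerJet σ b r h)^[n] (segmentJet σ b r s p) with hw
  have hwc : Continuous (fun q : ℝ × (ℝ × ℝ × ℝ) => w q.1 q.2) :=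
    ((continuous_eulerJet σ b r h).iterate n).comp (continuous_segmentJet σ b r)
  have hws : ∀ p, Continuous (fun s => w s p) := fun p =>
    hwc.comp (by fun_prop : Continuous fun s : ℝ => (s, p))
  set g : ℝ → ℝ := fun x =>
    tripleDot (lorenzField σ b r ((eulerTangent σ b r h)^[n] (parabolaTangent b 1 x)).1)
      ((eulerTangent σ b r h)^[n] (parabolaTangent b 1 x)).2 with hg
  have hgc : Continuous g := by
    have h1 : Continuous (fun x => (eulerTangent σ b r h)^[n] (parabolaTangent b 1 x)) := by
      refine ((continuous_eulerTangent σ b r h).iterate n).comp ?_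
      unfold parabolaTangent
      simp only [div_eq_mul_inv]
      fun_prop
    exact continuous_tripleDot.comp
      (((continuous_lorenzField σ b r).comp h1.fst).prodMk h1.snd)
  have hΓ : HasDerivAt (fun t => ∫ x in (0 : ℝ)..(u t).1, g x)
      (g (u t).1 * (lorenzField σ b r (u t)).1) t :=
    (intervalIntegral.integral_hasDerivAt_right (hgc.intervalIntegrable _ _)
      (hgc.stronglyMeasurableAtFilter _ _) hgc.continuousAt).comp t (hu t ht.le).triple_coords.1
  set F : ℝ → ℝ → ℝ := fun t s => tripleDot (lorenzField σ b r (w s (u t)).1) (w s (u t)).2.1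
  set Φ : ℝ × (ℝ × ℝ × ℝ) → ℝ := fun q =>
    tripleDot (lorenzDeriv σ b r (w q.1 q.2).1 (w q.1 q.2).2.2.1) (w q.1 q.2).2.1 +
      tripleDot (lorenzField σ b r (w q.1 q.2).1) (w q.1 q.2).2.2.2 with hΦ
  have hΦc : Continuous Φ := by
    unfold Φ tripleDot lorenzDeriv lorenzField
    fun_prop
  obtain ⟨M, hM⟩ := ((isCompact_Icc (a := (0 : ℝ)) (b := 1)).prod hK).exists_bound_of_continuousOn
    hΦc.continuousOn
  have hFc : ∀ t, Continuous (F t) := by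
    intro t
    have := hws (u t)
    unfold F tripleDot lorenzField
    fun_prop
  have hFd : ∀ t, 0 < t → ∀ s, HasDerivAt (fun t => F t s) (Φ (s, u t)) t := by
    intro t ht s
    obtain ⟨h1, h2⟩ := hasDerivAt_segmentJet_right s (hu t ht.le)
    obtain ⟨h3, h4⟩ := hasDerivAt_eulerJet_iterate_right (σ := σ) (b := b) (r := r) (h := h)
      (w := fun t => segmentJet σ b r s (u t)) h1 h2 n
    exact h3.lorenzField.tripleDot h4
  have hJ : HasDerivAt (fun t => ∫ s in (0 : ℝ)..1, F t s) (∫ s in (0 : ℝ)..1, Φ (s, u t)) t := by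
    refine (intervalIntegral.hasDerivAt_integral_of_dominated_loc_of_deriv_le
      (F' := fun t s => Φ (s, u t)) (bound := fun _ => M)
      (Ioi_mem_nhds ht) ?_ ((hFc t).intervalIntegrable _ _) ?_ ?_ ?_ ?_).2
    · exact Filter.Eventually.of_forall fun t => (hFc t).aestronglyMeasurable
    · exact (hΦc.comp (by fun_prop : Continuous fun s : ℝ => (s, u t))).aestronglyMeasurable
    · refine Filter.Eventually.of_forall fun s hs t ht => hM (s, u t) ⟨?_, huK t (le_of_lt ht)⟩
      rw [Set.uIoc_of_le zero_le_one] at hs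
      exact ⟨hs.1.le, hs.2⟩
    · exact intervalIntegrable_const
    · exact Filter.Eventually.of_forall fun s _ t ht => hFd t ht s
  have hstokes : ∫ s in (0 : ℝ)..1, Φ (s, u t) =
      (∫ s in (0 : ℝ)..1, lorenzCurl σ b r (w s (u t)).1 (w s (u t)).2.1 (w s (u t)).2.2.1) +
      (tripleDot (lorenzField σ b r (w 1 (u t)).1) (w 1 (u t)).2.2.1 -
        tripleDot (lorenzField σ b r (w 0 (u t)).1) (w 0 (u t)).2.2.1) := by
    have hd : ∀ s, HasDerivAt
        (fun s => tripleDot (lorenzField σ b r (w s (u t)).1) (w s (u t)).2.2.1)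
        (tripleDot (lorenzDeriv σ b r (w s (u t)).1 (w s (u t)).2.1) (w s (u t)).2.2.1 +
          tripleDot (lorenzField σ b r (w s (u t)).1) (w s (u t)).2.2.2) s := by
      intro s
      obtain ⟨h1, h2⟩ := hasDerivAt_segmentJet_left σ b r s (u t)
      obtain ⟨h3, h4⟩ := hasDerivAt_eulerJet_iterate_left (σ := σ) (b := b) (r := r) (h := h)
        (w := fun s => segmentJet σ b r s (u t)) h1 h2 n
      exact h3.lorenzField.tripleDot h4
    have := hws (u t)
    have hc1 : Continuous (fun s =>
        tripleDot (lorenzDeriv σ b r (w s (u t)).1 (w s (u t)).2.1) (w s (u t)).2.2.1 +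
          tripleDot (lorenzField σ b r (w s (u t)).1) (w s (u t)).2.2.2) := by
      unfold tripleDot lorenzDeriv lorenzField
      fun_prop
    have hc2 : Continuous (fun s =>
        lorenzCurl σ b r (w s (u t)).1 (w s (u t)).2.1 (w s (u t)).2.2.1) := by
      unfold lorenzCurl tripleDot lorenzDeriv
      fun_prop
    rw [← intervalIntegral.integral_eq_sub_of_hasDerivAt (fun s _ => hd s)
      (hc1.intervalIntegrable _ _), ← intervalIntegral.integral_add
      (hc2.intervalIntegrable _ _) (hc1.intervalIntegrable _ _)]
    congr 1
    funext s
    simp only [hΦ, lorenzCurl]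
    ring
  have h0 : tripleDot (lorenzField σ b r (w 0 (u t)).1) (w 0 (u t)).2.2.1 =
      g (u t).1 * (lorenzField σ b r (u t)).1 := by
    have e := eulerJet_iterate_tangent σ b r h n (segmentJet σ b r 0 (u t))
    have e2 : ((segmentJet σ b r 0 (u t)).1, (segmentJet σ b r 0 (u t)).2.2.1) =
        ((parabolaTangent b 1 (u t).1).1,
          (lorenzField σ b r (u t)).1 • (parabolaTangent b 1 (u t).1).2) := by
      simp [segmentJet, parabolaTangent, lorenzField]
    rw [e2, eulerTangent_iterate_smul] at e
    obtain ⟨e3, e4⟩ := Prod.mk.injEq _ _ _ _ ▸ e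
    simp only [hw, hg, e3, e4, Prod.mk.eta]
    simp only [tripleDot, Prod.smul_fst, Prod.smul_snd, smul_eq_mul]
    ring
  have h1 : tripleDot (lorenzField σ b r (w 1 (u t)).1) (w 1 (u t)).2.2.1 =
      tripleDot (lorenzField σ b r
          ((eulerTangent σ b r h)^[n] (u t, lorenzField σ b r (u t))).1)
        ((eulerTangent σ b r h)^[n] (u t, lorenzField σ b r (u t))).2 := by
    have e := eulerJet_iterate_tangent σ b r h n (segmentJet σ b r 1 (u t))
    have e2 : ((segmentJet σ b r 1 (u t)).1, (segmentJet σ b r 1 (u t)).2.2.1) =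
        (u t, lorenzField σ b r (u t)) := by
      simp [segmentJet]
    rw [e2] at e
    rw [← e]
  convert! hΓ.add hJ using 1
  rw [hstokes, h0, h1]
  ring

/-- Every ball is contained in a compact set which is invariant under all sufficiently small
Euler steps of the Lorenz field. -/
theorem exists_compact_euler_invariant {σ b r : ℝ} (hσ : 0 < σ) (hb : 0 < b) (hr : 0 < r)
    (ρ : ℝ) :
    ∃ K : Set (ℝ × ℝ × ℝ), IsCompact K ∧ (∀ p, ‖p‖ ≤ ρ → p ∈ K) ∧
      ∃ h₀ : ℝ, 0 < h₀ ∧ ∀ h : ℝ, 0 < h → h ≤ h₀ → ∀ p ∈ K, p + h • lorenzField σ b r p ∈ K := by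
  set c := σ + r with hc
  have hcpos : 0 < c := by positivity
  obtain ⟨κ, hκ, hκ1, hκ2, hκ3⟩ : ∃ κ : ℝ, 0 < κ ∧ κ ≤ σ ∧ κ ≤ 1 ∧ κ ≤ b / 2 :=
    ⟨min σ (min 1 (b / 2)), by positivity, min_le_left _ _,
      (min_le_right _ _).trans (min_le_left _ _), (min_le_right _ _).trans (min_le_right _ _)⟩
  set S := 2 * ρ ^ 2 + (|ρ| + c) ^ 2 + b * c ^ 2 / κ with hS
  have hSpos : 0 < S := by positivity
  have hSκ : b * c ^ 2 ≤ κ * S := by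
    have : κ * (b * c ^ 2 / κ) = b * c ^ 2 := by field_simp
    rw [hS, mul_add, this]
    have : 0 ≤ κ * (2 * ρ ^ 2 + (|ρ| + c) ^ 2) := by positivity
    linarith
  set K : Set (ℝ × ℝ × ℝ) := {p | p.1 ^ 2 + p.2.1 ^ 2 + (p.2.2 - c) ^ 2 ≤ S} with hK
  have hKc : IsCompact K := by
    refine (isCompact_closedBall (0 : ℝ × ℝ × ℝ) (S + 1 + c)).of_isClosed_subset
      (isClosed_le (by fun_prop) continuous_const) ?_
    rintro ⟨x, y, z⟩ hp
    simp only [hK, Set.mem_ofPred_eq] at hp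
    have h1 : |x| ≤ S + 1 := abs_le_of_sq_le_sq (by
      linarith [sq_nonneg y, sq_nonneg (z - c), sq_nonneg S]) (by positivity)
    have h2 : |y| ≤ S + 1 := abs_le_of_sq_le_sq (by
      linarith [sq_nonneg x, sq_nonneg (z - c), sq_nonneg S]) (by positivity)
    have h3 : |z - c| ≤ S + 1 := abs_le_of_sq_le_sq (by
      linarith [sq_nonneg x, sq_nonneg y, sq_nonneg S]) (by positivity)
    have h4 : |z| ≤ S + 1 + c := by
      have := abs_add_le (z - c) c
      rw [sub_add_cancel, abs_of_pos hcpos] at this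
      linarith
    simp only [mem_closedBall_zero_iff, Prod.norm_mk, Real.norm_eq_abs, max_le_iff]
    exact ⟨by linarith, by linarith, h4⟩
  obtain ⟨V, hV⟩ := hKc.exists_bound_of_continuousOn (continuous_lorenzField σ b r).continuousOn
  refine ⟨K, hKc, ?_, min (1 / (2 * κ)) (κ * S / (3 * V ^ 2 + 1)), by positivity, ?_⟩
  · rintro ⟨x, y, z⟩ hp
    simp only [Prod.norm_mk, Real.norm_eq_abs, max_le_iff] at hp
    obtain ⟨h1, h2, h3⟩ := hp
    have hρ : 0 ≤ ρ := (abs_nonneg x).trans h1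
    have e1 : x ^ 2 ≤ ρ ^ 2 := sq_le_sq' (abs_le.1 h1).1 (abs_le.1 h1).2
    have e2 : y ^ 2 ≤ ρ ^ 2 := sq_le_sq' (abs_le.1 h2).1 (abs_le.1 h2).2
    have e3 : (z - c) ^ 2 ≤ (ρ + c) ^ 2 :=
      sq_le_sq' (by linarith [(abs_le.1 h3).1]) (by linarith [(abs_le.1 h3).2])
    have : 0 ≤ b * c ^ 2 / κ := by positivity
    simp only [hK, Set.mem_ofPred_eq, hS, abs_of_nonneg hρ]
    linarith
  · intro h hh hle p hp
    have hh1 : h * (2 * κ) ≤ 1 := by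
      have := hle.trans (min_le_left _ _)
      rwa [le_div_iff₀ (by positivity)] at this
    have hh2 : h * (3 * V ^ 2 + 1) ≤ κ * S := by
      have := hle.trans (min_le_right _ _)
      rwa [le_div_iff₀ (by positivity)] at this
    have hVp := hV p hp
    obtain ⟨x, y, z⟩ := p
    simp only [hK, Set.mem_ofPred_eq, lorenzField, Prod.smul_mk, Prod.mk_add_mk, smul_eq_mul,
      Prod.norm_mk, Real.norm_eq_abs, max_le_iff] at hp hVp ⊢
    obtain ⟨v1, v2, v3⟩ := hVp
    have e1 := sq_le_sq' (abs_le.1 v1).1 (abs_le.1 v1).2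
    have e2 := sq_le_sq' (abs_le.1 v2).1 (abs_le.1 v2).2
    have e3 := sq_le_sq' (abs_le.1 v3).1 (abs_le.1 v3).2
    have i1 : h ^ 2 * ((σ * (y - x)) ^ 2 + (r * x - y - x * z) ^ 2 + (-b * z + x * y) ^ 2) ≤
        h * (κ * S) := by
      have : h ^ 2 * ((σ * (y - x)) ^ 2 + (r * x - y - x * z) ^ 2 + (-b * z + x * y) ^ 2) ≤
        h ^ 2 * (3 * V ^ 2 + 1) :=
        mul_le_mul_of_nonneg_left (by linarith) (sq_nonneg h)
      have := mul_le_mul_of_nonneg_left hh2 hh.le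
      linarith
    have i2 : -σ * x ^ 2 - y ^ 2 - b * (z - c) ^ 2 - b * c * (z - c) ≤
        -κ * (x ^ 2 + y ^ 2 + (z - c) ^ 2) + b * c ^ 2 / 2 := by
      have k1 := mul_le_mul_of_nonneg_right hκ1 (sq_nonneg x)
      have k2 := mul_le_mul_of_nonneg_right hκ2 (sq_nonneg y)
      have k3 := mul_le_mul_of_nonneg_right hκ3 (sq_nonneg (z - c))
      have k4 := mul_nonneg hb.le (sq_nonneg (z - c + c))
      linarith
    have i3 := mul_le_mul_of_nonneg_left i2 hh.le
    have i4 : (1 - h * (2 * κ)) * (x ^ 2 + y ^ 2 + (z - c) ^ 2) ≤ (1 - h * (2 * κ)) * S := by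
      gcongr
    have i5 := mul_le_mul_of_nonneg_left hSκ hh.le
    have key : (x + h * (σ * (y - x))) ^ 2 + (y + h * (r * x - y - x * z)) ^ 2 +
        (z + h * (-b * z + x * y) - c) ^ 2 = x ^ 2 + y ^ 2 + (z - c) ^ 2 +
        2 * (h * (-σ * x ^ 2 - y ^ 2 - b * (z - c) ^ 2 - b * c * (z - c))) +
        h ^ 2 * ((σ * (y - x)) ^ 2 + (r * x - y - x * z) ^ 2 + (-b * z + x * y) ^ 2) := by
      rw [hc]; ring
    rw [key]
    linarith

theorem tripleCross_norm_le (a c : ℝ × ℝ × ℝ) : ‖tripleCross a c‖ ≤ 2 * ‖a‖ * ‖c‖ := by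
  have key : ∀ s t v w : ℝ, |s| ≤ ‖a‖ → |t| ≤ ‖c‖ → |v| ≤ ‖a‖ → |w| ≤ ‖c‖ →
      |s * t - v * w| ≤ 2 * ‖a‖ * ‖c‖ := by
    intro s t v w h1 h2 h3 h4
    calc |s * t - v * w| ≤ |s| * |t| + |v| * |w| := by
          rw [← abs_mul, ← abs_mul]; exact abs_sub _ _
      _ ≤ ‖a‖ * ‖c‖ + ‖a‖ * ‖c‖ := by gcongr
      _ = _ := by ring
  have ha := norm_fst_le a
  have ha2 := (norm_fst_le a.2).trans (norm_snd_le a)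
  have ha3 := (norm_snd_le a.2).trans (norm_snd_le a)
  have hc := norm_fst_le c
  have hc2 := (norm_fst_le c.2).trans (norm_snd_le c)
  have hc3 := (norm_snd_le c.2).trans (norm_snd_le c)
  simp only [tripleCross, Prod.norm_mk, Real.norm_eq_abs, max_le_iff] at *
  exact ⟨key _ _ _ _ ha2 hc3 ha3 hc2, key _ _ _ _ ha3 hc ha hc3, key _ _ _ _ ha hc2 ha2 hc⟩

theorem abs_tripleDot_le (a c : ℝ × ℝ × ℝ) : |tripleDot a c| ≤ 3 * ‖a‖ * ‖c‖ := by
  have ha := norm_fst_le a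
  have ha2 := (norm_fst_le a.2).trans (norm_snd_le a)
  have ha3 := (norm_snd_le a.2).trans (norm_snd_le a)
  have hc := norm_fst_le c
  have hc2 := (norm_fst_le c.2).trans (norm_snd_le c)
  have hc3 := (norm_snd_le c.2).trans (norm_snd_le c)
  simp only [Real.norm_eq_abs] at *
  calc |tripleDot a c| ≤ |a.1| * |c.1| + |a.2.1| * |c.2.1| + |a.2.2| * |c.2.2| := by
        rw [← abs_mul, ← abs_mul, ← abs_mul]; exact abs_add_three _ _ _
    _ ≤ ‖a‖ * ‖c‖ + ‖a‖ * ‖c‖ + ‖a‖ * ‖c‖ := by gcongr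
    _ = _ := by ring

theorem norm_sq_le_tripleDot (a : ℝ × ℝ × ℝ) : ‖a‖ ^ 2 ≤ tripleDot a a := by
  obtain ⟨x, y, z⟩ := a
  simp only [tripleDot]
  rcases max_choice ‖x‖ ‖(y, z)‖ with h | h
  · rw [Prod.norm_mk, h, Real.norm_eq_abs, sq_abs]
    linarith [mul_self_nonneg y, mul_self_nonneg z]
  · rw [Prod.norm_mk, h, Prod.norm_mk]
    rcases max_choice ‖y‖ ‖z‖ with h | h
    · rw [h, Real.norm_eq_abs, sq_abs]
      linarith [mul_self_nonneg x, mul_self_nonneg z]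
    · rw [h, Real.norm_eq_abs, sq_abs]
      linarith [mul_self_nonneg x, mul_self_nonneg y]

theorem abs_lorenzCurl_le {σ b r : ℝ} (hσ : 0 < σ) (hr : 0 < r) (p a c : ℝ × ℝ × ℝ) :
    |lorenzCurl σ b r p a c| ≤ (σ + r + 4 * ‖p‖) * ‖tripleCross a c‖ := by
  have h1 := norm_fst_le p
  have h2 := (norm_fst_le p.2).trans (norm_snd_le p)
  have h3 := (norm_snd_le p.2).trans (norm_snd_le p)
  have h4 := norm_fst_le (tripleCross a c)
  have h5 := (norm_fst_le (tripleCross a c).2).trans (norm_snd_le _)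
  have h6 := (norm_snd_le (tripleCross a c).2).trans (norm_snd_le _)
  have e : lorenzCurl σ b r p a c = (σ - r + p.2.2) * (tripleCross a c).2.2
      + p.2.1 * (tripleCross a c).2.1 + (-2 * p.1) * (tripleCross a c).1 := by
    simp only [lorenzCurl, tripleDot, lorenzDeriv, tripleCross]; ring
  simp only [Real.norm_eq_abs] at *
  have h7 : |σ - r + p.2.2| ≤ σ + r + ‖p‖ := by
    refine abs_le.2 ⟨?_, ?_⟩ <;> linarith [(abs_le.1 h3).1, (abs_le.1 h3).2]
  have h8 : |-2 * p.1| ≤ 2 * ‖p‖ := by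
    rw [abs_mul]; norm_num; exact h1
  calc |lorenzCurl σ b r p a c| ≤ |σ - r + p.2.2| * |(tripleCross a c).2.2|
        + |p.2.1| * |(tripleCross a c).2.1| + |-2 * p.1| * |(tripleCross a c).1| := by
        rw [e, ← abs_mul, ← abs_mul, ← abs_mul]; exact abs_add_three _ _ _
    _ ≤ (σ + r + ‖p‖) * ‖tripleCross a c‖ + ‖p‖ * ‖tripleCross a c‖
        + 2 * ‖p‖ * ‖tripleCross a c‖ := by gcongr
    _ = _ := by ring

/-- Parallelograms carried along by Euler steps shrink at the rate given by the area metric. -/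
theorem eulerJet_iterate_area {σ b r h m C κ : ℝ} {K : Set (ℝ × ℝ × ℝ)}
    {G : ℝ × ℝ × ℝ → ℝ × ℝ × ℝ → ℝ}
    (hG : ∀ q ∈ K, ∀ c, m * ‖c‖ ^ 2 ≤ G q c ∧ G q c ≤ C * ‖c‖ ^ 2)
    (hstep : ∀ q ∈ K, ∀ c, G (q + h • lorenzField σ b r q)
      (c + h • lorenzArea σ b r q c + h ^ 2 • lorenzCofactor σ b r q c) ≤
        Real.exp (-κ * h) * G q c)
    (hinv : ∀ p ∈ K, p + h • lorenzField σ b r p ∈ K)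
    {w : (ℝ × ℝ × ℝ) × (ℝ × ℝ × ℝ) × (ℝ × ℝ × ℝ) × (ℝ × ℝ × ℝ)} (hw : w.1 ∈ K) (n : ℕ) :
    ((eulerJet σ b r h)^[n] w).1 ∈ K ∧
      m * ‖tripleCross ((eulerJet σ b r h)^[n] w).2.1 ((eulerJet σ b r h)^[n] w).2.2.1‖ ^ 2 ≤
        Real.exp (-κ * (h * n)) * (C * ‖tripleCross w.2.1 w.2.2.1‖ ^ 2) := by
  have key : ((eulerJet σ b r h)^[n] w).1 ∈ K ∧
      G ((eulerJet σ b r h)^[n] w).1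
        (tripleCross ((eulerJet σ b r h)^[n] w).2.1 ((eulerJet σ b r h)^[n] w).2.2.1) ≤
        Real.exp (-κ * (h * n)) * G w.1 (tripleCross w.2.1 w.2.2.1) := by
    induction n with
    | zero => simpa using hw
    | succ n ih =>
      obtain ⟨h1, h2⟩ := ih
      rw [Function.iterate_succ_apply']
      refine ⟨hinv _ h1, ?_⟩
      have h3 := hstep _ h1
        (tripleCross ((eulerJet σ b r h)^[n] w).2.1 ((eulerJet σ b r h)^[n] w).2.2.1)
      rw [← tripleCross_add_smul_lorenzDeriv] at h3
      have h4 := mul_le_mul_of_nonneg_left h2 (Real.exp_pos (-κ * h)).le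
      rw [← mul_assoc, ← Real.exp_add] at h4
      have h5 : -κ * h + -κ * (h * n) = -κ * (h * (n + 1 : ℕ)) := by push_cast; ring
      rw [h5] at h4
      exact h3.trans h4
  refine ⟨key.1, (hG _ key.1 _).1.trans (key.2.trans ?_)⟩
  gcongr
  exact (hG _ hw _).2

theorem norm_triple_le {x y z C : ℝ} (hx : |x| ≤ C) (hy : |y| ≤ C) (hz : |z| ≤ C) :
    ‖(x, y, z)‖ ≤ C := by
  simp only [Prod.norm_mk, Real.norm_eq_abs, max_le_iff]
  exact ⟨hx, hy, hz⟩

/-- The parallelograms spanned by the segments to the parabola are quadratically small in the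
Lorenz field. -/
theorem exists_segmentJet_area_le {σ b r : ℝ} (hσ : 0 < σ) (hb : 0 < b) (ρ : ℝ) :
    ∃ C, 0 ≤ C ∧ ∀ p, ‖p‖ ≤ ρ → ∀ s ∈ Set.Icc (0 : ℝ) 1,
      ‖tripleCross (segmentJet σ b r s p).2.1 (segmentJet σ b r s p).2.2.1‖ ≤
        C * ‖lorenzField σ b r p‖ ^ 2 := by
  set A := 1 / σ + (1 + |ρ| / σ) / b with hA
  set B := 1 + 2 * |ρ| / b with hB
  have hApos : 0 ≤ A := by positivity
  have hB1 : 1 ≤ B := by rw [hB]; linarith [show 0 ≤ 2 * |ρ| / b by positivity]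
  refine ⟨2 * A * (2 * B + 1), by positivity, fun p hp s hs => ?_⟩
  set g := ‖lorenzField σ b r p‖ with hg
  have hg0 : 0 ≤ g := norm_nonneg _
  obtain ⟨x, y, z⟩ := p
  have hρ : |x| ≤ |ρ| := (norm_fst_le (x, y, z)).trans (hp.trans (le_abs_self _))
  have f1 : |σ * (y - x)| ≤ g := norm_fst_le (lorenzField σ b r (x, y, z))
  have f3 : |-b * z + x * y| ≤ g :=
    (norm_snd_le (lorenzField σ b r (x, y, z)).2).trans (norm_snd_le _)
  have e1 : |y - x| ≤ 1 / σ * g := by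
    rw [abs_mul, abs_of_pos hσ] at f1
    rw [div_mul_eq_mul_div, le_div_iff₀ hσ]
    linarith
  have e2 : |z - x ^ 2 / b| ≤ (1 + |ρ| / σ) / b * g := by
    have : z - x ^ 2 / b = (x * (y - x) - (-b * z + x * y)) / b := by field_simp; ring
    rw [this, abs_div, abs_of_pos hb, div_mul_eq_mul_div]
    gcongr
    calc |x * (y - x) - (-b * z + x * y)| ≤ |x| * |y - x| + |-b * z + x * y| := by
          rw [← abs_mul]; exact abs_sub _ _
      _ ≤ |ρ| * (1 / σ * g) + g := by gcongr
      _ = (1 + |ρ| / σ) * g := by ring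
  have hseg : ‖(segmentJet σ b r s (x, y, z)).2.1‖ ≤ A * g := by
    simp only [segmentJet, parabolaTangent, Prod.mk_sub_mk]
    have : 0 ≤ 1 / σ * g := by positivity
    have : 0 ≤ (1 + |ρ| / σ) / b * g := by positivity
    have hA' : A * g = 1 / σ * g + (1 + |ρ| / σ) / b * g := by rw [hA]; ring
    refine norm_triple_le ?_ ?_ ?_
    · simp; positivity
    · linarith
    · linarith
  have hpar : ‖(parabolaTangent b (σ * (y - x)) x).2‖ ≤ B * g := by
    simp only [parabolaTangent, Prod.smul_mk, smul_eq_mul, mul_one]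
    have h1 : g ≤ B * g := le_mul_of_one_le_left hg0 hB1
    refine norm_triple_le (f1.trans h1) (f1.trans h1) ?_
    rw [abs_mul, mul_comm B]
    gcongr
    rw [abs_div, abs_mul, abs_of_pos hb, abs_two]
    have : 2 * |x| / b ≤ 2 * |ρ| / b := by gcongr
    linarith
  have hvel : ‖(segmentJet σ b r s (x, y, z)).2.2.1‖ ≤ (2 * B + 1) * g := by
    simp only [segmentJet]
    calc _ ≤ ‖(parabolaTangent b (σ * (y - x)) x).2‖ +
          ‖s • (lorenzField σ b r (x, y, z) - (parabolaTangent b (σ * (y - x)) x).2)‖ :=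
            norm_add_le _ _
      _ ≤ B * g + 1 * (g + B * g) := by
          rw [norm_smul, Real.norm_eq_abs, abs_of_nonneg hs.1]
          gcongr
          · exact hs.2
          · exact (norm_sub_le _ _).trans (by gcongr)
      _ = _ := by ring
  calc _ ≤ 2 * ‖(segmentJet σ b r s (x, y, z)).2.1‖ * ‖(segmentJet σ b r s (x, y, z)).2.2.1‖ :=
        tripleCross_norm_le _ _
    _ ≤ 2 * (A * g) * ((2 * B + 1) * g) := by gcongr
    _ = _ := by ring

theorem norm_segmentJet_fst_le {σ b r ρ s : ℝ} (hb : 0 < b) {p : ℝ × ℝ × ℝ} (hp : ‖p‖ ≤ ρ)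
    (hs : s ∈ Set.Icc (0 : ℝ) 1) : ‖(segmentJet σ b r s p).1‖ ≤ ρ + ρ ^ 2 / b := by
  have hρ : 0 ≤ ρ := (norm_nonneg p).trans hp
  have hρb : 0 ≤ ρ ^ 2 / b := by positivity
  have hx : |p.1| ≤ ρ := (norm_fst_le p).trans hp
  have hπ : ‖(parabolaTangent b (σ * (p.2.1 - p.1)) p.1).1‖ ≤ ρ + ρ ^ 2 / b := by
    refine norm_triple_le (by linarith) (by linarith) ?_
    rw [abs_div, abs_of_pos hb, abs_pow]
    have : |p.1| ^ 2 / b ≤ ρ ^ 2 / b := by gcongr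
    linarith
  have e : (segmentJet σ b r s p).1 =
      (1 - s) • (parabolaTangent b (σ * (p.2.1 - p.1)) p.1).1 + s • p := by
    simp only [segmentJet, smul_sub, sub_smul, one_smul]
    abel
  have := convex_closedBall (0 : ℝ × ℝ × ℝ) (ρ + ρ ^ 2 / b) (mem_closedBall_zero_iff.2 hπ)
    (mem_closedBall_zero_iff.2 (hp.trans (by linarith))) (sub_nonneg.2 hs.2) hs.1
    (sub_add_cancel 1 s)
  rw [e]
  exact mem_closedBall_zero_iff.1 this

/-- The failure of the pulled back Lorenz field to be closed is quadratically small in the Lorenz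
field, with a factor decaying exponentially in time. -/
theorem exists_integral_lorenzCurl_le {σ b r : ℝ} (hσ : 0 < σ) (hb : 0 < b) (hr : 0 < r)
    {K : Set (ℝ × ℝ × ℝ)} (hK : IsCompact K) {ρ h₀ m C κ h₁ : ℝ}
    (hρK : ∀ p, ‖p‖ ≤ ρ + ρ ^ 2 / b → p ∈ K)
    (hinv : ∀ h : ℝ, 0 < h → h ≤ h₀ → ∀ p ∈ K, p + h • lorenzField σ b r p ∈ K)
    {G : ℝ × ℝ × ℝ → ℝ × ℝ × ℝ → ℝ} (hm : 0 < m) (hC : 0 ≤ C)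
    (hG : ∀ q ∈ K, ∀ c, m * ‖c‖ ^ 2 ≤ G q c ∧ G q c ≤ C * ‖c‖ ^ 2)
    (hstep : ∀ h, 0 < h → h ≤ h₁ → ∀ q ∈ K, ∀ c, G (q + h • lorenzField σ b r q)
      (c + h • lorenzArea σ b r q c + h ^ 2 • lorenzCofactor σ b r q c) ≤
        Real.exp (-κ * h) * G q c) :
    ∃ Λ, 0 ≤ Λ ∧ ∀ h, 0 < h → h ≤ h₀ → h ≤ h₁ → ∀ (n : ℕ) p, ‖p‖ ≤ ρ →
      |∫ s in (0 : ℝ)..1, lorenzCurl σ b r ((eulerJet σ b r h)^[n] (segmentJet σ b r s p)).1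
        ((eulerJet σ b r h)^[n] (segmentJet σ b r s p)).2.1
        ((eulerJet σ b r h)^[n] (segmentJet σ b r s p)).2.2.1| ≤
      Λ * Real.exp (-(κ / 2) * (h * n)) * ‖lorenzField σ b r p‖ ^ 2 := by
  obtain ⟨A, hA, hAle⟩ := exists_segmentJet_area_le (r := r) hσ hb ρ
  obtain ⟨M, hM⟩ := hK.exists_bound_of_continuousOn continuousOn_id
  refine ⟨(σ + r + 4 * |M|) * (√(C / m) * A), by positivity, fun h hh hh0 hh1 n p hp => ?_⟩
  have hle : ∀ s ∈ Set.uIoc (0 : ℝ) 1,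
      ‖lorenzCurl σ b r ((eulerJet σ b r h)^[n] (segmentJet σ b r s p)).1
        ((eulerJet σ b r h)^[n] (segmentJet σ b r s p)).2.1
        ((eulerJet σ b r h)^[n] (segmentJet σ b r s p)).2.2.1‖ ≤
      (σ + r + 4 * |M|) * (√(C / m) * A) * Real.exp (-(κ / 2) * (h * n)) *
        ‖lorenzField σ b r p‖ ^ 2 := by
    intro s hs
    rw [Set.uIoc_of_le zero_le_one] at hs
    have hs' : s ∈ Set.Icc (0 : ℝ) 1 := ⟨hs.1.le, hs.2⟩
    obtain ⟨h1, h2⟩ := eulerJet_iterate_area hG (hstep h hh hh1) (hinv h hh hh0)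
      (hρK _ (norm_segmentJet_fst_le (σ := σ) (r := r) hb hp hs')) n
    set w := (eulerJet σ b r h)^[n] (segmentJet σ b r s p)
    have h3 : ‖tripleCross w.2.1 w.2.2.1‖ ≤
        √(C / m) * Real.exp (-(κ / 2) * (h * n)) * (A * ‖lorenzField σ b r p‖ ^ 2) := by
      refine le_of_sq_le_sq ?_ (by positivity)
      rw [mul_pow, mul_pow, Real.sq_sqrt (by positivity), ← Real.exp_nat_mul]
      have e : ((2 : ℕ) : ℝ) * (-(κ / 2) * (h * n)) = -κ * (h * n) := by push_cast; ring
      rw [e, div_mul_eq_mul_div, div_mul_eq_mul_div, le_div_iff₀ hm, mul_comm _ m]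
      refine h2.trans ?_
      have h4 := hAle p hp s hs'
      have : ‖tripleCross (segmentJet σ b r s p).2.1 (segmentJet σ b r s p).2.2.1‖ ^ 2 ≤
        (A * ‖lorenzField σ b r p‖ ^ 2) ^ 2 := by gcongr
      calc _ ≤ Real.exp (-κ * (h * n)) * (C * (A * ‖lorenzField σ b r p‖ ^ 2) ^ 2) := by gcongr
        _ = _ := by ring
    have h5 : ‖w.1‖ ≤ |M| := (hM _ h1).trans (le_abs_self M)
    calc _ ≤ (σ + r + 4 * ‖w.1‖) * ‖tripleCross w.2.1 w.2.2.1‖ := abs_lorenzCurl_le hσ hr _ _ _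
      _ ≤ (σ + r + 4 * |M|) *
          (√(C / m) * Real.exp (-(κ / 2) * (h * n)) * (A * ‖lorenzField σ b r p‖ ^ 2)) := by
          gcongr
      _ = _ := by ring
  simpa using intervalIntegral.norm_integral_le_of_norm_le_const hle

theorem exists_norm_lorenzDeriv_le (σ b r : ℝ) {K : Set (ℝ × ℝ × ℝ)} (hK : IsCompact K) :
    ∃ L, 0 ≤ L ∧ ∀ p ∈ K, ∀ a, ‖lorenzDeriv σ b r p a‖ ≤ L * ‖a‖ := by
  obtain ⟨M, hM⟩ := hK.exists_bound_of_continuousOn continuousOn_id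
  refine ⟨2 * |σ| + (|r| + 2 * |M| + 1) + (2 * |M| + |b|), by positivity, fun p hp a => ?_⟩
  have hpM : ‖p‖ ≤ |M| := (hM p hp).trans (le_abs_self M)
  have h1 : |p.1| ≤ |M| := (norm_fst_le p).trans hpM
  have h2 : |p.2.1| ≤ |M| := ((norm_fst_le p.2).trans (norm_snd_le p)).trans hpM
  have h3 : |p.2.2| ≤ |M| := ((norm_snd_le p.2).trans (norm_snd_le p)).trans hpM
  have a1 : |a.1| ≤ ‖a‖ := norm_fst_le a
  have a2 : |a.2.1| ≤ ‖a‖ := (norm_fst_le a.2).trans (norm_snd_le a)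
  have a3 : |a.2.2| ≤ ‖a‖ := (norm_snd_le a.2).trans (norm_snd_le a)
  have n1 : 0 ≤ 2 * |σ| * ‖a‖ := by positivity
  have n2 : 0 ≤ (|r| + 2 * |M| + 1) * ‖a‖ := by positivity
  have n3 : 0 ≤ (2 * |M| + |b|) * ‖a‖ := by positivity
  refine norm_triple_le ?_ ?_ ?_
  · have : |σ * (a.2.1 - a.1)| ≤ 2 * |σ| * ‖a‖ := by
      calc _ ≤ |σ| * (|a.2.1| + |a.1|) := by rw [abs_mul]; gcongr; exact abs_sub _ _
        _ ≤ |σ| * (‖a‖ + ‖a‖) := by gcongr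
        _ = _ := by ring
    linarith
  · have : |(r - p.2.2) * a.1 - a.2.1 - p.1 * a.2.2| ≤ (|r| + 2 * |M| + 1) * ‖a‖ := by
      calc _ ≤ |r - p.2.2| * |a.1| + |a.2.1| + |p.1| * |a.2.2| := by
            rw [← abs_mul, ← abs_mul]
            exact (abs_sub _ _).trans (by gcongr; exact abs_sub _ _)
        _ ≤ (|r| + |M|) * ‖a‖ + ‖a‖ + |M| * ‖a‖ := by
            gcongr
            exact (abs_sub _ _).trans (by gcongr)
        _ = _ := by ring
    linarith
  · have : |p.2.1 * a.1 + p.1 * a.2.1 - b * a.2.2| ≤ (2 * |M| + |b|) * ‖a‖ := by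
      calc _ ≤ |p.2.1| * |a.1| + |p.1| * |a.2.1| + |b| * |a.2.2| := by
            rw [← abs_mul, ← abs_mul, ← abs_mul]
            exact (abs_sub _ _).trans (by gcongr; exact abs_add_le _ _)
        _ ≤ |M| * ‖a‖ + |M| * ‖a‖ + |b| * ‖a‖ := by gcongr
        _ = _ := by ring
    linarith

/-- The quadratic part of the Lorenz vector field. -/
def lorenzQuad (a : ℝ × ℝ × ℝ) : ℝ × ℝ × ℝ :=
  (0, -(a.1 * a.2.2), a.1 * a.2.1)

theorem norm_lorenzQuad_le (a : ℝ × ℝ × ℝ) : ‖lorenzQuad a‖ ≤ ‖a‖ ^ 2 := by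
  have a1 : |a.1| ≤ ‖a‖ := norm_fst_le a
  have a2 : |a.2.1| ≤ ‖a‖ := (norm_fst_le a.2).trans (norm_snd_le a)
  have a3 : |a.2.2| ≤ ‖a‖ := (norm_snd_le a.2).trans (norm_snd_le a)
  refine norm_triple_le (by simp) ?_ ?_
  · rw [abs_neg, abs_mul, sq]; gcongr
  · rw [abs_mul, sq]; gcongr

theorem lorenzField_add_smul (σ b r h : ℝ) (p a : ℝ × ℝ × ℝ) :
    lorenzField σ b r (p + h • a) =
      lorenzField σ b r p + h • lorenzDeriv σ b r p a + h ^ 2 • lorenzQuad a := by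
  obtain ⟨x, y, z⟩ := p
  obtain ⟨a₁, a₂, a₃⟩ := a
  simp only [lorenzField, lorenzDeriv, lorenzQuad, Prod.smul_mk, Prod.mk_add_mk, smul_eq_mul,
    Prod.mk.injEq]
  refine ⟨?_, ?_, ?_⟩ <;> ring

theorem lorenzDeriv_sub (σ b r : ℝ) (p a c : ℝ × ℝ × ℝ) :
    lorenzDeriv σ b r p (a - c) = lorenzDeriv σ b r p a - lorenzDeriv σ b r p c := by
  simp only [lorenzDeriv, Prod.fst_sub, Prod.snd_sub, Prod.mk_sub_mk, Prod.mk.injEq]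
  refine ⟨?_, ?_, ?_⟩ <;> ring

/-- Along Euler steps started with the Lorenz field as tangent vector, the tangent vector stays
close to the Lorenz field. -/
theorem eulerTangent_iterate_bounds {σ b r h L M : ℝ} {K : Set (ℝ × ℝ × ℝ)} (hh : 0 < h)
    (hh1 : h ≤ 1) (hL : 0 ≤ L) (hM : 0 ≤ M)
    (hLK : ∀ p ∈ K, ∀ a, ‖lorenzDeriv σ b r p a‖ ≤ L * ‖a‖)
    (hMK : ∀ p ∈ K, ‖lorenzField σ b r p‖ ≤ M)
    (hinv : ∀ p ∈ K, p + h • lorenzField σ b r p ∈ K) {p : ℝ × ℝ × ℝ} (hp : p ∈ K) (n : ℕ) :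
    ((eulerTangent σ b r h)^[n] (p, lorenzField σ b r p)).1 ∈ K ∧
    ‖lorenzField σ b r ((eulerTangent σ b r h)^[n] (p, lorenzField σ b r p)).1‖ ≤
      (1 + h * (L + M)) ^ n * ‖lorenzField σ b r p‖ ∧
    ‖((eulerTangent σ b r h)^[n] (p, lorenzField σ b r p)).2‖ ≤
      (1 + h * (L + M)) ^ n * ‖lorenzField σ b r p‖ ∧
    ‖((eulerTangent σ b r h)^[n] (p, lorenzField σ b r p)).2 -
        lorenzField σ b r ((eulerTangent σ b r h)^[n] (p, lorenzField σ b r p)).1‖ ≤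
      h * (h * n) * M * ((1 + h * (L + M)) ^ n * ‖lorenzField σ b r p‖) := by
  induction n with
  | zero => simp [hp]
  | succ n ih =>
    rw [Function.iterate_succ_apply']
    set w := (eulerTangent σ b r h)^[n] (p, lorenzField σ b r p)
    obtain ⟨h1, h2, h3, h4⟩ := ih
    set X := (1 + h * (L + M)) ^ n * ‖lorenzField σ b r p‖ with hX
    have hX0 : 0 ≤ X := by positivity
    have hXs : (1 + h * (L + M)) ^ (n + 1) * ‖lorenzField σ b r p‖ = (1 + h * (L + M)) * X := by
      rw [hX, pow_succ]; ring
    rw [hXs]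
    set a := lorenzField σ b r w.1 with ha
    have hQ : ‖lorenzQuad a‖ ≤ M * X := by
      refine (norm_lorenzQuad_le a).trans ?_
      rw [sq]
      exact mul_le_mul (hMK _ h1) h2 (norm_nonneg _) hM
    have hLM : (1 + h * L) * X ≤ (1 + h * (L + M)) * X := by gcongr; linarith
    refine ⟨hinv _ h1, ?_, ?_, ?_⟩
    · simp only [eulerTangent, lorenzField_add_smul, ← ha]
      calc _ ≤ ‖a‖ + h * ‖lorenzDeriv σ b r w.1 a‖ + h ^ 2 * ‖lorenzQuad a‖ := by
            refine (norm_add_le _ _).trans ?_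
            rw [norm_smul, norm_pow, Real.norm_eq_abs, abs_of_pos hh]
            gcongr
            refine (norm_add_le _ _).trans ?_
            rw [norm_smul, Real.norm_eq_abs, abs_of_pos hh]
        _ ≤ X + h * (L * X) + (h * 1) * (M * X) := by
            rw [sq]
            gcongr
            exact (hLK _ h1 a).trans (by gcongr)
        _ = _ := by ring
    · simp only [eulerTangent]
      calc _ ≤ ‖w.2‖ + h * ‖lorenzDeriv σ b r w.1 w.2‖ := by
            refine (norm_add_le _ _).trans ?_
            rw [norm_smul, Real.norm_eq_abs, abs_of_pos hh]
        _ ≤ X + h * (L * X) := by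
            gcongr
            exact (hLK _ h1 w.2).trans (by gcongr)
        _ ≤ _ := by linarith
    · simp only [eulerTangent, lorenzField_add_smul, ← ha]
      set ρ := w.2 - a with hρ
      have e : w.2 + h • lorenzDeriv σ b r w.1 w.2
          - (a + h • lorenzDeriv σ b r w.1 a + h ^ 2 • lorenzQuad a) =
          ρ + h • lorenzDeriv σ b r w.1 ρ - h ^ 2 • lorenzQuad a := by
        rw [hρ, lorenzDeriv_sub, smul_sub]; abel
      rw [e]
      have h5 : ‖ρ + h • lorenzDeriv σ b r w.1 ρ‖ ≤ (1 + h * L) * ‖ρ‖ := by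
        refine (norm_add_le _ _).trans ?_
        rw [norm_smul, Real.norm_eq_abs, abs_of_pos hh]
        have := mul_le_mul_of_nonneg_left (hLK _ h1 ρ) hh.le
        linarith
      have h6 : X ≤ (1 + h * (L + M)) * X := le_mul_of_one_le_left hX0 (by
        linarith [show 0 ≤ h * (L + M) by positivity])
      calc _ ≤ (1 + h * L) * ‖ρ‖ + h ^ 2 * ‖lorenzQuad a‖ := by
            refine (norm_sub_le _ _).trans ?_
            rw [norm_smul, norm_pow, Real.norm_eq_abs, abs_of_pos hh]
            gcongr
        _ ≤ (1 + h * (L + M)) * (h * (h * n) * M * X) + h ^ 2 * (M * X) := by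
            gcongr
            linarith
        _ ≤ (1 + h * (L + M)) * (h * (h * n) * M * X)
            + h ^ 2 * (M * ((1 + h * (L + M)) * X)) := by gcongr
        _ = _ := by push_cast; ring

theorem tripleDot_euler_step_le {σ b r h L M X Y : ℝ} {p a d : ℝ × ℝ × ℝ} (hh : 0 < h)
    (hh1 : h ≤ 1) (hL : 0 ≤ L) (hM : 0 ≤ M) (hLp : ∀ a, ‖lorenzDeriv σ b r p a‖ ≤ L * ‖a‖)
    (haM : ‖a‖ ≤ M) (haX : ‖a‖ ≤ X) (hdX : ‖d‖ ≤ X) (hda : ‖d - a‖ ≤ h * Y) :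
    |tripleDot (a + h • lorenzDeriv σ b r p a + h ^ 2 • lorenzQuad a)
          (d + h • lorenzDeriv σ b r p d) - tripleDot a d
        - h * (2 * tripleDot a (lorenzDeriv σ b r p d))| ≤
      h ^ 2 * (6 * L * X * Y + 3 * L ^ 2 * X ^ 2 + 3 * M * (1 + L) * X ^ 2) := by
  have hX : 0 ≤ X := (norm_nonneg a).trans haX
  have hY : 0 ≤ h * Y := (norm_nonneg _).trans hda
  set J := lorenzDeriv σ b r p with hJ
  have e : tripleDot (a + h • J a + h ^ 2 • lorenzQuad a) (d + h • J d) - tripleDot a d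
      - h * (2 * tripleDot a (J d)) =
      h * (tripleDot (d - a) (J d) - tripleDot (J (d - a)) d) + h ^ 2 * tripleDot (J a) (J d)
        + h ^ 2 * tripleDot (lorenzQuad a) (d + h • J d) := by
    rw [hJ, lorenzDeriv_sub]
    simp only [tripleDot, Prod.fst_add, Prod.snd_add, Prod.smul_fst, Prod.smul_snd, smul_eq_mul,
      Prod.fst_sub, Prod.snd_sub]
    ring
  have hJa : ‖J a‖ ≤ L * X := (hLp a).trans (by gcongr)
  have hJd : ‖J d‖ ≤ L * X := (hLp d).trans (by gcongr)
  have hJr : ‖J (d - a)‖ ≤ L * (h * Y) := (hLp _).trans (by gcongr)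
  have hQ : ‖lorenzQuad a‖ ≤ M * X := by
    refine (norm_lorenzQuad_le a).trans ?_
    rw [sq]
    exact mul_le_mul haM haX (norm_nonneg _) hM
  have hdJ : ‖d + h • J d‖ ≤ (1 + L) * X := by
    refine (norm_add_le _ _).trans ?_
    rw [norm_smul, Real.norm_eq_abs, abs_of_pos hh]
    calc _ ≤ X + 1 * (L * X) := by gcongr
      _ = _ := by ring
  have t1 : |tripleDot (d - a) (J d)| ≤ 3 * (h * Y) * (L * X) :=
    (abs_tripleDot_le _ _).trans (by gcongr)
  have t2 : |tripleDot (J (d - a)) d| ≤ 3 * (L * (h * Y)) * X :=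
    (abs_tripleDot_le _ _).trans (by gcongr)
  have t3 : |tripleDot (J a) (J d)| ≤ 3 * (L * X) * (L * X) :=
    (abs_tripleDot_le _ _).trans (by gcongr)
  have t4 : |tripleDot (lorenzQuad a) (d + h • J d)| ≤ 3 * (M * X) * ((1 + L) * X) :=
    (abs_tripleDot_le _ _).trans (by gcongr)
  rw [e]
  calc _ ≤ h * (|tripleDot (d - a) (J d)| + |tripleDot (J (d - a)) d|)
        + h ^ 2 * |tripleDot (J a) (J d)| + h ^ 2 * |tripleDot (lorenzQuad a) (d + h • J d)| := by
        refine (abs_add_three _ _ _).trans ?_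
        rw [abs_mul, abs_mul, abs_mul, abs_of_pos hh, abs_of_pos (pow_pos hh 2)]
        gcongr
        exact abs_sub _ _
    _ ≤ h * (3 * (h * Y) * (L * X) + 3 * (L * (h * Y)) * X)
        + h ^ 2 * (3 * (L * X) * (L * X)) + h ^ 2 * (3 * (M * X) * ((1 + L) * X)) := by gcongr
    _ = _ := by ring

/-- A discrete energy identity: over a bounded time, the Lorenz field paired with its transported
tangent vector changes by the derivative of the kinetic energy spent, up to an error of first order
in the step size. -/
theorem exists_euler_energy_le {σ b r h₀ : ℝ} {K : Set (ℝ × ℝ × ℝ)} (hK : IsCompact K)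
    (hinv : ∀ h : ℝ, 0 < h → h ≤ h₀ → ∀ p ∈ K, p + h • lorenzField σ b r p ∈ K) {T : ℝ}
    (hT : 0 ≤ T) :
    ∃ C, 0 ≤ C ∧ ∀ h, 0 < h → h ≤ h₀ → h ≤ 1 → ∀ n : ℕ, h * n ≤ T → ∀ p ∈ K,
      |tripleDot (lorenzField σ b r ((eulerTangent σ b r h)^[n] (p, lorenzField σ b r p)).1)
          ((eulerTangent σ b r h)^[n] (p, lorenzField σ b r p)).2
        - tripleDot (lorenzField σ b r p) (lorenzField σ b r p)
        - h * ∑ k ∈ Finset.range n, 2 * tripleDot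
            (lorenzField σ b r ((eulerTangent σ b r h)^[k] (p, lorenzField σ b r p)).1)
            (lorenzDeriv σ b r ((eulerTangent σ b r h)^[k] (p, lorenzField σ b r p)).1
              ((eulerTangent σ b r h)^[k] (p, lorenzField σ b r p)).2)| ≤
        C * h * ‖lorenzField σ b r p‖ ^ 2 := by
  obtain ⟨L, hL, hLK⟩ := exists_norm_lorenzDeriv_le σ b r hK
  obtain ⟨M', hM'⟩ := hK.exists_bound_of_continuousOn (continuous_lorenzField σ b r).continuousOn
  set M := |M'|
  have hM : 0 ≤ M := abs_nonneg _
  have hMK : ∀ p ∈ K, ‖lorenzField σ b r p‖ ≤ M := fun p hp => (hM' p hp).trans (le_abs_self _)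
  set Ξ := Real.exp (T * (L + M)) with hΞ
  set E := 6 * L * Ξ * (T * M * Ξ) + 3 * L ^ 2 * Ξ ^ 2 + 3 * M * (1 + L) * Ξ ^ 2 with hE
  have hE0 : 0 ≤ E := by positivity
  refine ⟨T * E, by positivity, fun h hh hh0 hh1 n hn p hp => ?_⟩
  set g := ‖lorenzField σ b r p‖ with hg
  have hΞn : ∀ n : ℕ, h * n ≤ T → (1 + h * (L + M)) ^ n ≤ Ξ := by
    intro n hn
    calc (1 + h * (L + M)) ^ n ≤ Real.exp (h * (L + M)) ^ n := by
          gcongr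
          linarith [Real.add_one_le_exp (h * (L + M))]
      _ = Real.exp (h * n * (L + M)) := by rw [← Real.exp_nat_mul]; ring_nf
      _ ≤ Ξ := by rw [hΞ]; gcongr
  have key : ∀ n : ℕ, h * n ≤ T →
      |tripleDot (lorenzField σ b r ((eulerTangent σ b r h)^[n] (p, lorenzField σ b r p)).1)
          ((eulerTangent σ b r h)^[n] (p, lorenzField σ b r p)).2
        - tripleDot (lorenzField σ b r p) (lorenzField σ b r p)
        - h * ∑ k ∈ Finset.range n, 2 * tripleDot
            (lorenzField σ b r ((eulerTangent σ b r h)^[k] (p, lorenzField σ b r p)).1)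
            (lorenzDeriv σ b r ((eulerTangent σ b r h)^[k] (p, lorenzField σ b r p)).1
              ((eulerTangent σ b r h)^[k] (p, lorenzField σ b r p)).2)| ≤
        h * n * (h * (E * g ^ 2)) := by
    intro n
    induction n with
    | zero => intro _; simp
    | succ n ih =>
      intro hn
      have hn' : h * n ≤ T := by push_cast at hn; linarith
      have ih := ih hn'
      obtain ⟨b1, b2, b3, b4⟩ :=
        eulerTangent_iterate_bounds hh hh1 hL hM hLK hMK (hinv h hh hh0) hp n
      have hX : (1 + h * (L + M)) ^ n * g ≤ Ξ * g := by
        gcongr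
        exact hΞn n hn'
      have hda := b4.trans (show _ ≤ h * (T * M * Ξ * g) by
        calc h * (h * n) * M * ((1 + h * (L + M)) ^ n * g) ≤ h * T * M * (Ξ * g) := by gcongr
          _ = _ := by ring)
      have step := tripleDot_euler_step_le hh hh1 hL hM (hLK _ b1) (hMK _ b1) (b2.trans hX)
        (b3.trans hX) hda
      rw [Finset.sum_range_succ, Function.iterate_succ_apply']
      set w := (eulerTangent σ b r h)^[n] (p, lorenzField σ b r p)
      have e1 : (eulerTangent σ b r h w).1 = w.1 + h • lorenzField σ b r w.1 := rfl
      have e2 : (eulerTangent σ b r h w).2 = w.2 + h • lorenzDeriv σ b r w.1 w.2 := rfl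
      rw [e1, e2, lorenzField_add_smul]
      have e3 : h ^ 2 * (6 * L * (Ξ * g) * (T * M * Ξ * g) + 3 * L ^ 2 * (Ξ * g) ^ 2
          + 3 * M * (1 + L) * (Ξ * g) ^ 2) = h * (h * (E * g ^ 2)) := by rw [hE]; ring
      rw [e3] at step
      have := (abs_add_le _ _).trans (add_le_add ih step)
      refine le_trans (le_of_eq ?_) (this.trans (le_of_eq ?_))
      · congr 1; ring
      · push_cast; ring
  refine (key n hn).trans ?_
  calc h * n * (h * (E * g ^ 2)) ≤ T * (h * (E * g ^ 2)) := by gcongr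
    _ = _ := by ring

/-- A bounded function controls a nonnegative function with `|φ'| ≤ C φ` if its derivative
dominates that function. -/
theorem tendsto_zero_of_le_deriv {U U' φ φ' : ℝ → ℝ} {B C ε : ℝ} (hε : 0 < ε)
    (hU : ∀ t, 0 < t → HasDerivAt U (U' t) t) (hφ : ∀ t, 0 < t → HasDerivAt φ (φ' t) t)
    (hUB : ∀ t, 0 < t → |U t| ≤ B) (hφ0 : ∀ t, 0 < t → 0 ≤ φ t)
    (hUφ : ∀ t, 0 < t → ε * φ t ≤ U' t) (hφC : ∀ t, 0 < t → |φ' t| ≤ C * φ t) :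
    Filter.Tendsto φ Filter.atTop (nhds 0) := by
  have conv : ∀ V V' : ℝ → ℝ, ∀ B, (∀ t, 0 < t → HasDerivAt V (V' t) t) →
      (∀ t, 0 < t → 0 ≤ V' t) → (∀ t, 0 < t → V t ≤ B) →
        ∃ l, Filter.Tendsto V Filter.atTop (nhds l) := by
    intro V V' B hV hV' hB
    have hmono : MonotoneOn V (Set.Ioi 0) := by
      refine monotoneOn_of_hasDerivWithinAt_nonneg (f' := V') (convex_Ioi 0)
        (fun t ht => (hV t ht).continuousAt.continuousWithinAt) ?_ ?_
      · intro t ht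
        rw [interior_Ioi] at ht
        exact (hV t ht).hasDerivWithinAt
      · intro t ht
        rw [interior_Ioi] at ht
        exact hV' t ht
    have hpos : ∀ t : ℝ, 0 < max t 1 := fun t => one_pos.trans_le (le_max_right _ _)
    have hm : Monotone (fun t => V (max t 1)) := fun s t hst =>
      hmono (hpos s) (hpos t) (max_le_max_right 1 hst)
    refine ⟨_, (tendsto_atTop_ciSup hm ⟨B, ?_⟩).congr' ?_⟩
    · rintro _ ⟨t, rfl⟩
      exact hB _ (hpos t)
    · filter_upwards [Filter.eventually_ge_atTop 1] with t ht
      rw [max_eq_left ht]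
  have hC : ∀ t, 0 < t → 0 ≤ C * φ t := fun t ht => (abs_nonneg _).trans (hφC t ht)
  obtain ⟨l₁, hl₁⟩ := conv U U' B hU
    (fun t ht => (mul_nonneg hε.le (hφ0 t ht)).trans (hUφ t ht))
    (fun t ht => (abs_le.1 (hUB t ht)).2)
  obtain ⟨l₂, hl₂⟩ := conv (fun t => |C| / ε * U t - φ t) (fun t => |C| / ε * U' t - φ' t)
    (|C| / ε * B) (fun t ht => ((hU t ht).const_mul _).sub (hφ t ht)) (fun t ht => by
      have h1 := mul_le_mul_of_nonneg_left (hUφ t ht) (show 0 ≤ |C| / ε by positivity)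
      have h2 : |C| / ε * (ε * φ t) = |C| * φ t := by field_simp
      have h3 := mul_le_mul_of_nonneg_right (le_abs_self C) (hφ0 t ht)
      have h4 := (abs_le.1 (hφC t ht)).2
      linarith) (fun t ht => by
      have h1 := mul_le_mul_of_nonneg_left (abs_le.1 (hUB t ht)).2
        (show 0 ≤ |C| / ε by positivity)
      linarith [hφ0 t ht])
  obtain ⟨l, hl⟩ : ∃ l, Filter.Tendsto φ Filter.atTop (nhds l) := by
    refine ⟨_, ((hl₁.const_mul (|C| / ε)).sub hl₂).congr fun t => ?_⟩
    ring
  have hl0 : 0 ≤ l := ge_of_tendsto hl ((Filter.eventually_gt_atTop 0).mono hφ0)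
  rcases hl0.eq_or_lt with rfl | hlpos
  · exact hl
  exfalso
  obtain ⟨t₀, ht₀⟩ := ((hl.eventually (lt_mem_nhds (half_lt_self hlpos))).and
    (Filter.eventually_gt_atTop 0)).exists_forall_of_atTop
  have ht₀pos : 0 < t₀ := (ht₀ t₀ le_rfl).2
  have hmono : MonotoneOn (fun t => U t - ε * (l / 2) * t) (Set.Ici t₀) := by
    refine monotoneOn_of_hasDerivWithinAt_nonneg (f' := fun t => U' t - ε * (l / 2) * 1)
      (convex_Ici t₀) (fun t ht => ?_) ?_ ?_
    · exact ((hU t (ht₀pos.trans_le ht)).continuousAt.sub (by fun_prop)).continuousWithinAt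
    · intro t ht
      rw [interior_Ici] at ht
      exact ((hU t (ht₀pos.trans ht)).sub
        ((hasDerivAt_id t).const_mul (ε * (l / 2)))).hasDerivWithinAt
    · intro t ht
      rw [interior_Ici] at ht
      have h1 := mul_le_mul_of_nonneg_left (ht₀ t (le_of_lt ht)).1.le hε.le
      have h2 := hUφ t (ht₀pos.trans ht)
      linarith
  have hB : 0 ≤ B := (abs_nonneg _).trans (hUB t₀ ht₀pos)
  have hle : t₀ ≤ t₀ + (2 * B + 1) / (ε * (l / 2)) := le_add_of_nonneg_right (by positivity)
  have h1 := hmono (Set.self_mem_Ici) (Set.mem_Ici.2 hle) hle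
  have h2 := (abs_le.1 (hUB t₀ ht₀pos)).1
  have h3 := (abs_le.1 (hUB _ (ht₀pos.trans_le hle))).2
  have h4 : ε * (l / 2) * (t₀ + (2 * B + 1) / (ε * (l / 2))) =
      ε * (l / 2) * t₀ + (2 * B + 1) := by field_simp
  simp only [h4] at h1
  linarith

/-- A bounded curve along which the Lorenz field tends to zero converges to an equilibrium. -/
theorem exists_tendsto_of_lorenzField_tendsto_zero {σ b r : ℝ} (hσ : 0 < σ) (hb : 0 < b)
    {u : ℝ → ℝ × ℝ × ℝ} (hc : ContinuousOn u (Set.Ici 0)) {ρ : ℝ} (hρ : ∀ t, 0 ≤ t → ‖u t‖ ≤ ρ)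
    (hf : Filter.Tendsto (fun t => lorenzField σ b r (u t)) Filter.atTop (nhds 0)) :
    ∃ p, lorenzField σ b r p = 0 ∧ Filter.Tendsto u Filter.atTop (nhds p) := by
  have hρ0 : 0 ≤ ρ := (norm_nonneg _).trans (hρ 0 le_rfl)
  have hx : ∀ t, 0 ≤ t → |(u t).1| ≤ ρ := fun t ht => (norm_fst_le _).trans (hρ t ht)
  have hf1 : Filter.Tendsto (fun t => σ * ((u t).2.1 - (u t).1)) Filter.atTop (nhds 0) :=
    (continuous_fst.tendsto _).comp hf
  have hf2 : Filter.Tendsto (fun t => r * (u t).1 - (u t).2.1 - (u t).1 * (u t).2.2)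
      Filter.atTop (nhds 0) :=
    ((continuous_fst.comp continuous_snd).tendsto _).comp hf
  have hf3 : Filter.Tendsto (fun t => -b * (u t).2.2 + (u t).1 * (u t).2.1) Filter.atTop (nhds 0) :=
    ((continuous_snd.comp continuous_snd).tendsto _).comp hf
  have hbx : ∀ g : ℝ → ℝ, Filter.Tendsto g Filter.atTop (nhds 0) →
      Filter.Tendsto (fun t => (u t).1 * g t) Filter.atTop (nhds 0) := by
    intro g hg
    have : Filter.Tendsto (fun t => ρ * |g t|) Filter.atTop (nhds 0) := by
      simpa using (hg.abs).const_mul ρ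
    refine squeeze_zero_norm' ?_ this
    filter_upwards [Filter.eventually_ge_atTop 0] with t ht
    rw [Real.norm_eq_abs, abs_mul]
    gcongr
    exact hx t ht
  have hyx : Filter.Tendsto (fun t => (u t).2.1 - (u t).1) Filter.atTop (nhds 0) := by
    have := hf1.const_mul σ⁻¹
    rw [mul_zero] at this
    exact this.congr fun t => by field_simp
  have hz : Filter.Tendsto (fun t => (u t).2.2 - (u t).1 ^ 2 / b) Filter.atTop (nhds 0) := by
    have := ((hbx _ hyx).sub hf3).const_mul b⁻¹
    rw [sub_zero, mul_zero] at this
    exact this.congr fun t => by field_simp; ring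
  have hcub : Filter.Tendsto (fun t => (u t).1 * (r - 1 - (u t).1 ^ 2 / b))
      Filter.atTop (nhds 0) := by
    have := (hf2.add hyx).add (hbx _ hz)
    simp only [add_zero] at this
    exact this.congr fun t => by ring
  have hbdd : ∀ᶠ t in Filter.atTop, |(u t).1| ≤ ρ := (Filter.eventually_ge_atTop 0).mono hx
  obtain ⟨x, hxlim⟩ : ∃ x, Filter.Tendsto (fun t => (u t).1) Filter.atTop (nhds x) := by
    refine tendsto_of_no_upcrossings dense_univ ?_
      (Filter.isBoundedUnder_of_eventually_le (hbdd.mono fun t ht => (abs_le.1 ht).2))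
      (Filter.isBoundedUnder_of_eventually_ge (hbdd.mono fun t ht => (abs_le.1 ht).1))
    rintro a - c - hac ⟨ha, hc'⟩
    obtain ⟨e, ⟨hae, hec⟩, he⟩ : ∃ e ∈ Set.Ioo a c, e * (r - 1 - e ^ 2 / b) ≠ 0 := by
      have hfin : ({0, √(b * (r - 1)), -√(b * (r - 1))} : Set ℝ).Finite := by simp
      obtain ⟨e, he, hne⟩ := (Set.Ioo_infinite hac).exists_notMem_finite hfin
      simp only [Set.mem_insert_iff, Set.mem_singleton_iff, not_or] at hne
      refine ⟨e, he, mul_ne_zero hne.1 fun h0 => ?_⟩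
      have h2 : e ^ 2 = b * (r - 1) := by
        field_simp at h0
        linarith
      have h3 : √(b * (r - 1)) = |e| := by rw [← h2, Real.sqrt_sq_eq_abs]
      rcases abs_choice e with h | h
      · exact hne.2.1 (by rw [h3, h])
      · exact hne.2.2 (by rw [h3, h, neg_neg])
    obtain ⟨t₀, ht₀⟩ := ((hcub.eventually (isOpen_ne.mem_nhds he.symm)).and
      (Filter.eventually_ge_atTop 0)).exists_forall_of_atTop
    obtain ⟨t₁, ht₁, hta⟩ := Filter.frequently_atTop.1 ha t₀
    obtain ⟨t₂, ht₂, htc⟩ := Filter.frequently_atTop.1 hc' t₀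
    have hge : ∀ t ∈ Set.uIcc t₁ t₂, t₀ ≤ t := fun t ht => (le_inf ht₁ ht₂).trans ht.1
    obtain ⟨t, ht, hte⟩ := intermediate_value_uIcc (f := fun t => (u t).1)
      (continuous_fst.comp_continuousOn (hc.mono fun t ht => (ht₀ t (hge t ht)).2))
      (Set.Icc_subset_uIcc ⟨(hta.trans hae).le, (hec.trans htc).le⟩)
    exact (ht₀ t (hge t ht)).1 (by simp only [← hte])
  have hylim : Filter.Tendsto (fun t => (u t).2.1) Filter.atTop (nhds x) := by
    simpa using hyx.add hxlim
  have hzlim : Filter.Tendsto (fun t => (u t).2.2) Filter.atTop (nhds (x ^ 2 / b)) := by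
    simpa using hz.add ((hxlim.pow 2).div_const b)
  have hlim : Filter.Tendsto u Filter.atTop (nhds (x, x, x ^ 2 / b)) :=
    hxlim.prodMk_nhds (hylim.prodMk_nhds hzlim)
  exact ⟨_, tendsto_nhds_unique (((continuous_lorenzField σ b r).tendsto _).comp hlim) hf, hlim⟩

theorem continuous_lineFunctional (σ b r h : ℝ) (n : ℕ) :
    Continuous (lineFunctional σ b r h n) := by
  refine Continuous.add ?_ ?_
  · refine (intervalIntegral.continuous_primitive (fun x y => Continuous.intervalIntegrable ?_ x y)
      0).comp continuous_fst
    have h1 : Continuous (fun x => (eulerTangent σ b r h)^[n] (parabolaTangent b 1 x)) := by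
      refine ((continuous_eulerTangent σ b r h).iterate n).comp ?_
      unfold parabolaTangent
      simp only [div_eq_mul_inv]
      fun_prop
    exact continuous_tripleDot.comp
      (((continuous_lorenzField σ b r).comp h1.fst).prodMk h1.snd)
  · refine intervalIntegral.continuous_parametric_intervalIntegral_of_continuous' ?_ _ _
    have h1 : Continuous (fun q : (ℝ × ℝ × ℝ) × ℝ =>
        (eulerJet σ b r h)^[n] (segmentJet σ b r q.2 q.1)) :=
      (((continuous_eulerJet σ b r h).iterate n).comp (continuous_segmentJet σ b r)).comp
        continuous_swap
    exact continuous_tripleDot.comp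
      (((continuous_lorenzField σ b r).comp h1.fst).prodMk h1.snd.fst)

theorem hasDerivAt_eulerTangent_iterate {σ b r h : ℝ} {u : ℝ → ℝ × ℝ × ℝ} {t : ℝ}
    (hu : HasDerivAt u (lorenzField σ b r (u t)) t) (n : ℕ) :
    HasDerivAt (fun t => ((eulerTangent σ b r h)^[n] (u t, lorenzField σ b r (u t))).1)
      ((eulerTangent σ b r h)^[n] (u t, lorenzField σ b r (u t))).2 t := by
  induction n with
  | zero => exact hu
  | succ n ih =>
    simp only [Function.iterate_succ_apply']
    exact ih.add (ih.lorenzField.const_smul h)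

/-- The line functional corrected by the kinetic energy spent along Euler steps. -/
noncomputable def eulerLyapunov (σ b r h : ℝ) (n : ℕ) (p : ℝ × ℝ × ℝ) : ℝ :=
  lineFunctional σ b r h n p - h * ∑ k ∈ Finset.range n,
    tripleDot (lorenzField σ b r ((eulerTangent σ b r h)^[k] (p, lorenzField σ b r p)).1)
      (lorenzField σ b r ((eulerTangent σ b r h)^[k] (p, lorenzField σ b r p)).1)

theorem continuous_eulerLyapunov (σ b r h : ℝ) (n : ℕ) :
    Continuous (eulerLyapunov σ b r h n) := by
  refine (continuous_lineFunctional σ b r h n).sub (continuous_const.mul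
    (continuous_finsetSum _ fun k _ => ?_))
  have h1 : Continuous (fun p => (eulerTangent σ b r h)^[k] (p, lorenzField σ b r p)) :=
    ((continuous_eulerTangent σ b r h).iterate k).comp
      (continuous_id.prodMk (continuous_lorenzField σ b r))
  exact continuous_tripleDot.comp (((continuous_lorenzField σ b r).comp h1.fst).prodMk
    ((continuous_lorenzField σ b r).comp h1.fst))

theorem hasDerivAt_eulerLyapunov {σ b r : ℝ} {u : ℝ → ℝ × ℝ × ℝ} {K : Set (ℝ × ℝ × ℝ)}
    (hK : IsCompact K) (huK : ∀ t, 0 ≤ t → u t ∈ K)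
    (hu : ∀ t : ℝ, 0 ≤ t → HasDerivAt u (lorenzField σ b r (u t)) t) (h : ℝ) (n : ℕ)
    {t : ℝ} (ht : 0 < t) :
    HasDerivAt (fun t => eulerLyapunov σ b r h n (u t))
      (tripleDot (lorenzField σ b r
          ((eulerTangent σ b r h)^[n] (u t, lorenzField σ b r (u t))).1)
        ((eulerTangent σ b r h)^[n] (u t, lorenzField σ b r (u t))).2 +
      (∫ s in (0 : ℝ)..1, lorenzCurl σ b r ((eulerJet σ b r h)^[n] (segmentJet σ b r s (u t))).1
        ((eulerJet σ b r h)^[n] (segmentJet σ b r s (u t))).2.1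
        ((eulerJet σ b r h)^[n] (segmentJet σ b r s (u t))).2.2.1) -
      h * ∑ k ∈ Finset.range n, 2 * tripleDot
        (lorenzField σ b r ((eulerTangent σ b r h)^[k] (u t, lorenzField σ b r (u t))).1)
        (lorenzDeriv σ b r ((eulerTangent σ b r h)^[k] (u t, lorenzField σ b r (u t))).1
          ((eulerTangent σ b r h)^[k] (u t, lorenzField σ b r (u t))).2)) t := by
  refine (hasDerivAt_lineFunctional hK huK hu h n ht).sub
    ((HasDerivAt.fun_sum fun k _ => ?_).const_mul h)
  have h1 := (hasDerivAt_eulerTangent_iterate (h := h) (hu t ht.le) k).lorenzField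
      (σ := σ) (b := b) (r := r)
  convert! h1.tripleDot h1 using 1
  simp only [tripleDot]
  ring

/-- Exponential area contraction along Euler steps forces bounded solutions of the Lorenz system to
converge. -/
theorem exists_tendsto_of_area_contraction {σ b r : ℝ} (hσ : 0 < σ) (hb : 0 < b) (hr : 0 < r)
    (hmetric : ∀ K : Set (ℝ × ℝ × ℝ), IsCompact K →
      ∃ (G : ℝ × ℝ × ℝ → ℝ × ℝ × ℝ → ℝ) (m C κ h₀ : ℝ), 0 < m ∧ 0 ≤ C ∧ 0 < κ ∧ 0 < h₀ ∧
        (∀ q ∈ K, ∀ c, m * ‖c‖ ^ 2 ≤ G q c ∧ G q c ≤ C * ‖c‖ ^ 2) ∧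
        ∀ h, 0 < h → h ≤ h₀ → ∀ q ∈ K, ∀ c,
          G (q + h • lorenzField σ b r q)
            (c + h • lorenzArea σ b r q c + h ^ 2 • lorenzCofactor σ b r q c) ≤
              Real.exp (-κ * h) * G q c)
    {u : ℝ → ℝ × ℝ × ℝ} (hu : ∀ t : ℝ, 0 ≤ t → HasDerivAt u (lorenzField σ b r (u t)) t) {ρ : ℝ}
    (hρ : ∀ t, 0 ≤ t → ‖u t‖ ≤ ρ) :
    ∃ p, lorenzField σ b r p = 0 ∧ Filter.Tendsto u Filter.atTop (nhds p) := by
  obtain ⟨K, hK, hρK, h₀, hh₀, hinv⟩ :=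
    exists_compact_euler_invariant hσ hb hr (ρ + ρ ^ 2 / b)
  have huK : ∀ t, 0 ≤ t → u t ∈ K := fun t ht =>
    hρK _ ((hρ t ht).trans (le_add_of_nonneg_right (by positivity)))
  obtain ⟨G, m, C, κ, h₁, hm, hC, hκ, hh₁, hG, hstep⟩ := hmetric K hK
  obtain ⟨Λ, hΛ, hcurl⟩ := exists_integral_lorenzCurl_le hσ hb hr hK hρK hinv hm hC hG hstep
  obtain ⟨L, hL, hLK⟩ := exists_norm_lorenzDeriv_le σ b r hK
  set T := 8 * Λ / κ + 1 with hT
  have hTpos : 0 < T := by positivity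
  have hΛT : Λ * Real.exp (-(κ / 2) * T) ≤ 1 / 4 := by
    have e1 : 4 * Λ ≤ Real.exp (κ / 2 * T) := by
      have e2 : κ / 2 * T = 4 * Λ + κ / 2 := by rw [hT]; field_simp; ring
      linarith [Real.add_one_le_exp (κ / 2 * T)]
    rw [neg_mul, Real.exp_neg, ← div_eq_mul_inv, div_le_iff₀ (Real.exp_pos _)]
    linarith
  obtain ⟨E, hE, henergy⟩ := exists_euler_energy_le hK hinv hTpos.le
  obtain ⟨h, n, hh, hhn, hle0, hle1, hle2, hle3⟩ : ∃ (h : ℝ) (n : ℕ), 0 < h ∧ h * n = T ∧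
      h ≤ h₀ ∧ h ≤ h₁ ∧ h ≤ 1 ∧ E * h ≤ 1 / 4 := by
    set δ := min (min h₀ h₁) (min 1 (1 / (4 * (E + 1)))) with hδ
    have hδpos : 0 < δ := by positivity
    obtain ⟨n, hn⟩ := exists_nat_gt (T / δ)
    have hnpos : (0 : ℝ) < n := (by positivity : 0 < T / δ).trans hn
    have hnδ : T / n ≤ δ := by
      rw [div_lt_iff₀ hδpos] at hn
      rw [div_le_iff₀ hnpos]
      linarith
    refine ⟨T / n, n, by positivity, by field_simp, ?_, ?_, ?_, ?_⟩
    · exact hnδ.trans ((min_le_left _ _).trans (min_le_left _ _))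
    · exact hnδ.trans ((min_le_left _ _).trans (min_le_right _ _))
    · exact hnδ.trans ((min_le_right _ _).trans (min_le_left _ _))
    · have h1 : T / n ≤ 1 / (4 * (E + 1)) :=
        hnδ.trans ((min_le_right _ _).trans (min_le_right _ _))
      rw [le_div_iff₀ (by positivity)] at h1
      linarith [show 0 ≤ T / n by positivity]
  obtain ⟨B, hB⟩ := hK.exists_bound_of_continuousOn
    (continuous_eulerLyapunov σ b r h n).continuousOn
  have hφ := tendsto_zero_of_le_deriv (B := B) (C := 6 * L) (one_half_pos (α := ℝ))
    (fun t ht => hasDerivAt_eulerLyapunov hK huK hu h n ht)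
    (fun t ht => ((hu t ht.le).lorenzField (σ := σ) (b := b) (r := r)).tripleDot
        ((hu t ht.le).lorenzField (σ := σ) (b := b) (r := r)))
    (fun t ht => hB _ (huK t ht.le))
    (fun t ht => (sq_nonneg _).trans (norm_sq_le_tripleDot _))
    (fun t ht => by
      have e1 := hcurl h hh hle0 hle1 n (u t) (hρ t ht.le)
      have e2 := henergy h hh hle0 hle2 n hhn.le (u t) (huK t ht.le)
      have e3 := norm_sq_le_tripleDot (lorenzField σ b r (u t))
      rw [hhn] at e1
      have e4 := mul_le_mul_of_nonneg_right hΛT (sq_nonneg ‖lorenzField σ b r (u t)‖)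
      have e5 := mul_le_mul_of_nonneg_right hle3 (sq_nonneg ‖lorenzField σ b r (u t)‖)
      have e6 := (abs_le.1 e1).1
      have e7 := (abs_le.1 e2).1
      linarith)
    (fun t ht => by
      have e1 := hLK _ (huK t ht.le) (lorenzField σ b r (u t))
      have e3 := norm_sq_le_tripleDot (lorenzField σ b r (u t))
      set a := lorenzField σ b r (u t)
      set c := lorenzDeriv σ b r (u t) a
      calc _ ≤ 3 * ‖c‖ * ‖a‖ + 3 * ‖a‖ * ‖c‖ :=
            (abs_add_le _ _).trans (add_le_add (abs_tripleDot_le _ _) (abs_tripleDot_le _ _))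
        _ = 6 * (‖c‖ * ‖a‖) := by ring
        _ ≤ 6 * (L * ‖a‖ * ‖a‖) := by gcongr
        _ = 6 * L * ‖a‖ ^ 2 := by ring
        _ ≤ 6 * L * tripleDot a a := by gcongr)
  refine exists_tendsto_of_lorenzField_tendsto_zero hσ hb
    (fun t ht => (hu t ht).continuousAt.continuousWithinAt) hρ ?_
  have hsqrt := (Real.continuous_sqrt.tendsto 0).comp hφ
  rw [Real.sqrt_zero] at hsqrt
  exact squeeze_zero_norm (fun t => Real.le_sqrt_of_sq_le (norm_sq_le_tripleDot _)) hsqrt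

theorem stmt_0 (σ b r : ℝ) (hσ : 0 < σ) (hb : 0 < b) (hr : 0 < r)
    (h1 : r - 1 > 0)
    (h2 : r - 1 ≥ (b * (b + σ - 1)^2 - 4 * σ * (b + σ * b - b^2)) / (3 * σ^2))
    (hab :
      (σ^2 * (r - 1) * (b - 4) ≤ 4 * σ * (σ * b + b - b^2) - b * (b + σ - 1)^2) ∨
      (0 < b * (b + σ - 1)^2 - 4 * σ * (σ * b + b - b^2) + σ^2 * (r - 1) * (b - 4) ∧
        ∃ γI γII : ℝ, γI < γII ∧ 0 < γII ∧
          (2 * σ - b + γI)^2 *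
              (b * (b + σ - 1)^2 - 4 * σ * (σ * b + b - b^2) + σ^2 * (r - 1) * (b - 4)) +
            4 * b * γI * (σ + 1) *
              (b * (b + σ - 1)^2 - 4 * σ * (σ * b + b - b^2) - 3 * σ^2 * (r - 1)) = 0 ∧
          (2 * σ - b + γII)^2 *
              (b * (b + σ - 1)^2 - 4 * σ * (σ * b + b - b^2) + σ^2 * (r - 1) * (b - 4)) +
            4 * b * γII * (σ + 1) *
              (b * (b + σ - 1)^2 - 4 * σ * (σ * b + b - b^2) - 3 * σ^2 * (r - 1)) = 0))
    (h3 : (b - σ) * (b - 1) < σ * r) (h4 : σ * r < (b + 1) * (b + σ))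
    (u : ℝ → ℝ × ℝ × ℝ)
    (hu : ∀ t : ℝ, 0 ≤ t → HasDerivAt u (lorenzField σ b r (u t)) t)
    (hbdd : Bornology.IsBounded (u '' Set.Ici (0 : ℝ))) :
    ∃ p : ℝ × ℝ × ℝ, lorenzField σ b r p = 0 ∧
      Filter.Tendsto u Filter.atTop (nhds p) := by
  have hD : 0 < σ * r - (b - σ) * (b - 1) := by linarith
  have hQ : b * (b + σ - 1)^2 - 4 * σ * (σ * b + b - b^2) - 3 * σ^2 * (r - 1) ≤ 0 := by
    have := (div_le_iff₀ (by positivity)).1 h2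
    linarith
  obtain ⟨k, e, d, hk, hd, hS, hz, hdisc⟩ := exists_potential_coeffs hσ hb h1 hD hQ (by
    rcases hab with hab | ⟨hP, γI, γII, -, hγ, -, hγeq⟩
    · exact Or.inl (by linarith)
    · exact Or.inr ⟨hP, γII, hγ, hγeq⟩)
  have hα : (b + σ - 1) ^ 2 / (σ * r - (b - σ) * (b - 1)) =
      σ ^ 2 / (σ * r - (b - σ) * (b - 1)) * (b + σ - 1) ^ 2 / σ ^ 2 := by
    field_simp
  rw [hα] at hS
  obtain ⟨v, dv, rem, hv, hrem, htaylor, hdv⟩ := exists_potential hb hσ hk hd hS hz hdisc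
  obtain ⟨ρ, hρ⟩ := hbdd.exists_norm_le
  exact exists_tendsto_of_area_contraction hσ hb hr
    (fun K hK => exists_area_metric hσ hb hr hD h4 hv hrem htaylor hdv hK) hu
    (fun t ht => hρ _ ⟨t, ht, rfl⟩)
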